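/- arXiv:1706.06732 — 2 statements merged into one kernel-verified Lean document; each statement's English description precedes it below -/
import Mathlib

section
/- Let λ ≥ 0 and ε > 0. Assume L̄ is differentiable on (λ, λ+ε) and sup{L̄'(t) : t ∈ (λ, λ+ε)} is not attained; if λ = 0 and L̄'_r(0⁺) = −∞, assume further that L̄ is right continuous at zero. For z ∈ [L̄'_r(λ⁺), L̄'_l(λ+ε)) let t_z ∈ [λ, λ+ε) satisfy L̄'_r(t_z⁺) = z. Then the map z ↦ L̄(t_z⁺) − t_z·z on [L̄'_r(λ⁺), L̄'_l(λ+ε)) is well defined (independent of the choice of t_z), takes values in (−∞, 0], is strictly decreasing and continuous, is unbounded below if and only if L̄'_l(λ+ε) = +∞, and vanishes at L̄'_r(λ⁺) if and only if either λ > 0, L̄ is differentiable at λ and L̄ is linear on [0, λ], or λ = 0 and L̄ is right continuous at zero. Its restriction to the open interval (L̄'_r(λ⁺), L̄'_l(λ+ε)) is strictly concave, and it is moreover differentiable there whenever L̄ is strictly convex on (λ̃, λ+ε), where λ̃ := sup{t > λ : L̄ is affine on (λ, t]}. -/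
open Filter MeasureTheory Set Topology

noncomputable section

/-- `c · log m` as an extended real number, where `m ∈ [0,∞]`. -/
def elog (c : ℝ) (m : ENNReal) : EReal := (c : EReal) * ENNReal.log m

/-- The generalized log-moment generating function `L̄` associated with the net
`(μ_α, c_α)` indexed by the filter `lf`:
`L̄(t) = limsup_α c_α · log ∫ exp(t·x/c_α) dμ_α(x)`. -/
def genLogMGF {ι : Type*} (lf : Filter ι) (μ : ι → Measure ℝ) (c : ι → ℝ) (t : ℝ) : EReal :=
  Filter.limsup
    (fun i => elog (c i) (∫⁻ x : ℝ, ENNReal.ofReal (Real.exp (t * x / c i)) ∂ (μ i))) lf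

/-- Legendre–Fenchel transform of an `EReal`-valued function on `ℝ`, evaluated at an
extended real argument: `L*(x) = sup_t (t·x − L(t))`. -/
def LegendreEE (L : ℝ → EReal) (x : EReal) : EReal := ⨆ t : ℝ, ((t : EReal) * x - L t)

open Classical in
/-- The right derivative of a convex `EReal`-valued function at `t`, with the conventions
`L'_r(t) = +∞` when `L(s) = +∞` for all `s > t` and `L'_r(t) = -∞` when `L(s) = -∞` for
some `s > t`; otherwise it is the infimum of the right difference quotients. -/
def rightDerivE (L : ℝ → EReal) (t : ℝ) : EReal :=
  if ∀ s : ℝ, t < s → L s = ⊤ then ⊤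
  else if ∃ s : ℝ, t < s ∧ L s = ⊥ then ⊥
  else ⨅ s ∈ Set.Ioi t, (L s - L t) * (((s - t)⁻¹ : ℝ) : EReal)

/-- The left derivative of a convex `EReal`-valued function at `t` (supremum of left
difference quotients). -/
def leftDerivE (L : ℝ → EReal) (t : ℝ) : EReal :=
  ⨆ s ∈ Set.Iio t, (L t - L s) * (((t - s)⁻¹ : ℝ) : EReal)

/-- Right limit at `a` of an `EReal`-valued function (as a `limsup`; it coincides with
`lim_{t→a⁺} f(t)` whenever the latter exists, e.g. for monotone or convex `f`). -/
def rightLimE (f : ℝ → EReal) (a : ℝ) : EReal := Filter.limsup f (nhdsWithin a (Set.Ioi a))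

/-- Left limit at `a` of an `EReal`-valued function (as a `limsup`; it coincides with
`lim_{t→a⁻} f(t)` whenever the latter exists). -/
def leftLimE (f : ℝ → EReal) (a : ℝ) : EReal := Filter.limsup f (nhdsWithin a (Set.Iio a))

/-- `L` is affine on the interval `(a, b]`. -/
def AffineOnIoc (L : ℝ → EReal) (a b : ℝ) : Prop :=
  ∃ p q : ℝ, ∀ s ∈ Set.Ioc a b, L s = ((p * s + q : ℝ) : EReal)

/-- `λ̃ = sup {t > λ : L is affine on (λ, t]}` (equal to `λ` if there is no such `t`). -/
def tildeOf (L : ℝ → EReal) (lam : ℝ) : ℝ :=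
  sSup (insert lam {t : ℝ | lam < t ∧ AffineOnIoc L lam t})

/-- Differentiability at `t` of an `EReal`-valued function: `L(t)` is finite and the
difference quotients converge to a (finite) real number. -/
def EDifferentiableAt (L : ℝ → EReal) (t : ℝ) : Prop :=
  (∃ r : ℝ, L t = (r : EReal)) ∧
  ∃ d : ℝ, Filter.Tendsto (fun s => (L s - L t) * (((s - t)⁻¹ : ℝ) : EReal))
    (nhdsWithin t {t}ᶜ) (nhds (d : EReal))

/-- The function `l₀(x) = − lim_{ε→0⁺} limsup_α c_α · log μ_α((x−ε, x+ε))` (the limit over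
`ε` exists by monotonicity and equals the infimum). -/
def l0fun {ι : Type*} (lf : Filter ι) (μ : ι → Measure ℝ) (c : ι → ℝ) (x : ℝ) : EReal :=
  - ⨅ ε ∈ Set.Ioi (0:ℝ),
      Filter.limsup (fun i => elog (c i) (μ i (Set.Ioo (x - ε) (x + ε)))) lf

/-- `L` restricted to `[0,∞)` is proper: `(−∞,+∞]`-valued with at least one finite value. -/
def LbarProper (L : ℝ → EReal) : Prop :=
  (∀ t : ℝ, 0 ≤ t → L t ≠ ⊥) ∧ ∃ t : ℝ, 0 ≤ t ∧ L t ≠ ⊤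

/-- `μ([x, y])` for extended-real endpoints `x, y`, with `μ` regarded as a measure on
`[-∞, +∞]`. -/
def muIccE (μ : Measure ℝ) (x y : EReal) : ENNReal :=
  μ {z : ℝ | x ≤ (z : EReal) ∧ (z : EReal) ≤ y}

/-- `μ((x, y))` for extended-real endpoints `x, y`. -/
def muIooE (μ : Measure ℝ) (x y : EReal) : ENNReal :=
  μ {z : ℝ | x < (z : EReal) ∧ (z : EReal) < y}

open Classical in
/-- The Legendre transform extended to `[-∞,+∞]` by continuity, with the paper's
convention `L̄*(−∞) = −L̄(0⁺)`. -/
def LegendreExt (L : ℝ → EReal) (x : EReal) : EReal :=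
  if x = ⊥ then -(rightLimE L 0) else if x = ⊤ then ⊤ else LegendreEE L x

end

/-- The closed-open interval `[L̄'_r(λ⁺), L̄'_l(λ+ε))` in the extended reals. -/
def domD (L : ℝ → EReal) (lam eps : ℝ) : Set EReal :=
  {w : EReal | rightLimE (rightDerivE L) lam ≤ w ∧ w < leftLimE (rightDerivE L) (lam + eps)}

/-- The real points of the open interval `(L̄'_r(λ⁺), L̄'_l(λ+ε))`. -/
def domDR (L : ℝ → EReal) (lam eps : ℝ) : Set ℝ :=
  {p : ℝ | rightLimE (rightDerivE L) lam < (p : EReal) ∧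
    (p : EReal) < leftLimE (rightDerivE L) (lam + eps)}

/-! ### The concave conjugate of a differentiable convex function on an interval -/

/-- `f` is differentiable on `(a, b)` with derivative `g` and lies above its tangents there. -/
structure ConvexDerivOn (f g : ℝ → ℝ) (a b : ℝ) : Prop where
  nonneg : 0 ≤ a
  lt : a < b
  tangent : ∀ s ∈ Ioo a b, ∀ t ∈ Ioo a b, f t + g t * (s - t) ≤ f s
  hasDerivAt : ∀ t ∈ Ioo a b, HasDerivAt f (g t) t

/-- The concave conjugate `z ↦ inf_{t ∈ (a, b)} (f t - t z)`. -/
noncomputable def concaveConj (f : ℝ → ℝ) (a b z : ℝ) : ℝ :=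
  sInf ((fun t => f t - t * z) '' Ioo a b)

namespace ConvexDerivOn

variable {f g : ℝ → ℝ} {a b : ℝ}

lemma monotoneOn (h : ConvexDerivOn f g a b) : MonotoneOn g (Ioo a b) := by
  intro s hs t ht hst
  rcases hst.eq_or_lt with rfl | hlt
  · exact le_rfl
  have h1 := h.tangent s hs t ht
  have h2 := h.tangent t ht s hs
  by_contra! hc
  nlinarith

lemma exists_mem (h : ConvexDerivOn f g a b) : ∃ t, t ∈ Ioo a b :=
  nonempty_Ioo.2 h.lt

lemma bddBelow (h : ConvexDerivOn f g a b) (z : ℝ) :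
    BddBelow ((fun t => f t - t * z) '' Ioo a b) := by
  obtain ⟨t, ht⟩ := h.exists_mem
  refine ⟨f t - g t * t - |g t - z| * b, ?_⟩
  rintro _ ⟨s, hs, rfl⟩
  have h1 := h.tangent s hs t ht
  have h2 : -(|g t - z| * b) ≤ (g t - z) * s := by
    have hs0 : 0 ≤ s := h.nonneg.trans hs.1.le
    have := neg_abs_le (g t - z)
    have h3 : |g t - z| * s ≤ |g t - z| * b :=
      mul_le_mul_of_nonneg_left hs.2.le (abs_nonneg _)
    nlinarith
  show f t - g t * t - |g t - z| * b ≤ f s - s * z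
  nlinarith

lemma conj_le (h : ConvexDerivOn f g a b) (z : ℝ) {t : ℝ} (ht : t ∈ Ioo a b) :
    concaveConj f a b z ≤ f t - t * z :=
  csInf_le (h.bddBelow z) (mem_image_of_mem _ ht)

lemma le_conj (h : ConvexDerivOn f g a b) {y z : ℝ}
    (hy : ∀ t ∈ Ioo a b, y ≤ f t - t * z) : y ≤ concaveConj f a b z := by
  refine le_csInf ((nonempty_Ioo.2 h.lt).image _) ?_
  rintro _ ⟨t, ht, rfl⟩
  exact hy t ht

lemma conj_deriv (h : ConvexDerivOn f g a b) {t : ℝ} (ht : t ∈ Ioo a b) :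
    concaveConj f a b (g t) = f t - t * g t := by
  refine le_antisymm (h.conj_le _ ht) (h.le_conj fun s hs => ?_)
  linarith [h.tangent s hs t ht]

lemma conj_lt_of_ne (h : ConvexDerivOn f g a b) {t z : ℝ} (ht : t ∈ Ioo a b) (hz : g t ≠ z) :
    concaveConj f a b z < f t - t * z := by
  refine lt_of_le_of_ne (h.conj_le z ht) fun heq => hz ?_
  have hmin : IsLocalMin (fun s => f s - s * z) t := by
    filter_upwards [Ioo_mem_nhds ht.1 ht.2] with s hs
    rw [← heq]
    exact h.conj_le z hs
  have hd : HasDerivAt (fun s => f s - s * z) (g t - 1 * z) t :=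
    (h.hasDerivAt t ht).sub ((hasDerivAt_id t).mul_const z)
  linarith [hmin.hasDerivAt_eq_zero hd]

lemma conj_sub_le (h : ConvexDerivOn f g a b) {z z' : ℝ} (hz : z ≤ z') :
    concaveConj f a b z - concaveConj f a b z' ≤ b * (z' - z) := by
  have : concaveConj f a b z - b * (z' - z) ≤ concaveConj f a b z' := by
    refine h.le_conj fun t ht => ?_
    have := h.conj_le z ht
    nlinarith [ht.2]
  linarith

lemma conj_antitone (h : ConvexDerivOn f g a b) : Antitone (concaveConj f a b) := by
  intro z z' hz
  refine h.le_conj fun t ht => (h.conj_le z' ht).trans ?_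
  have : 0 < t := h.nonneg.trans_lt ht.1
  nlinarith

lemma conj_continuous (h : ConvexDerivOn f g a b) : Continuous (concaveConj f a b) := by
  have hb : 0 ≤ b := h.nonneg.trans h.lt.le
  refine (LipschitzWith.of_le_add_mul' b fun x y => ?_).continuous
  rw [Real.dist_eq]
  rcases le_total x y with hxy | hxy
  · rw [abs_sub_comm, abs_of_nonneg (sub_nonneg.2 hxy)]
    linarith [h.conj_sub_le hxy]
  · have := h.conj_antitone hxy
    have := mul_nonneg hb (abs_nonneg (x - y))
    linarith

lemma conj_lt_conj (h : ConvexDerivOn f g a b) {t z : ℝ} (ht : t ∈ Ioo a b) (hz : g t < z) :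
    concaveConj f a b z < concaveConj f a b (g t) := by
  rw [h.conj_deriv ht]
  have h0 : 0 < t := h.nonneg.trans_lt ht.1
  have := h.conj_le z ht
  nlinarith

lemma exists_deriv_eq (h : ConvexDerivOn f g a b) {s t z : ℝ} (hs : s ∈ Ioo a b)
    (ht : t ∈ Ioo a b) (hsz : g s < z) (hzt : z < g t) : ∃ u ∈ Ioo a b, g u = z := by
  have := (ordConnected_Ioo (a := a) (b := b)).image_hasDerivWithinAt
    fun x hx => (h.hasDerivAt x hx).hasDerivWithinAt
  exact this.out (mem_image_of_mem g hs) (mem_image_of_mem g ht) ⟨hsz.le, hzt.le⟩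

lemma lt_of_deriv_lt (h : ConvexDerivOn f g a b) {s t : ℝ} (hs : s ∈ Ioo a b)
    (ht : t ∈ Ioo a b) (hst : g s < g t) : s < t := by
  by_contra! hc
  exact absurd (h.monotoneOn ht hs hc) (not_le.2 hst)

lemma tendsto_deriv_right (h : ConvexDerivOn f g a b)
    (hsup : ∀ t ∈ Ioo a b, ∃ s ∈ Ioo a b, g t < g s) {t : ℝ} (ht : t ∈ Ioo a b) :
    Tendsto g (𝓝[>] t) (𝓝 (g t)) := by
  refine tendsto_order.2 ⟨fun l hl => ?_, fun u hu => ?_⟩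
  · filter_upwards [Ioo_mem_nhdsGT ht.2] with s hs
    exact hl.trans_le (h.monotoneOn ht ⟨ht.1.trans hs.1, hs.2⟩ hs.1.le)
  · obtain ⟨s, hs, hts⟩ := hsup t ht
    obtain ⟨z, hz1, hz2⟩ := exists_between (lt_min hu hts)
    obtain ⟨v, hv, rfl⟩ := h.exists_deriv_eq ht hs hz1 (hz2.trans_le (min_le_right _ _))
    have htv := h.lt_of_deriv_lt ht hv hz1
    filter_upwards [Ioo_mem_nhdsGT htv] with s hs
    exact (h.monotoneOn ⟨ht.1.trans hs.1, hs.2.trans hv.2⟩ hv hs.2.le).trans_lt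
      (hz2.trans_le (min_le_left _ _))

lemma strictConcaveOn_conj (h : ConvexDerivOn f g a b) {D : Set ℝ} (hD : Convex ℝ D)
    (hatt : ∀ p ∈ D, ∃ t ∈ Ioo a b, g t = p) : StrictConcaveOn ℝ D (concaveConj f a b) := by
  refine ⟨hD, fun p hp q hq hpq α β hα hβ hαβ => ?_⟩
  obtain ⟨t, ht, hgt⟩ := hatt _ (hD hp hq hα.le hβ.le hαβ)
  simp only [smul_eq_mul] at hgt ⊢
  rw [← hgt, h.conj_deriv ht, hgt]
  have hβ' : β = 1 - α := by linarith
  have hne : g t ≠ p := by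
    rw [hgt]
    intro hc
    apply hpq
    have : β * (q - p) = 0 := by subst hβ'; linear_combination hc
    rcases mul_eq_zero.1 this with h0 | h0 <;> linarith
  have h1 := mul_lt_mul_of_pos_left (h.conj_lt_of_ne ht hne) hα
  have h2 := mul_le_mul_of_nonneg_left (h.conj_le q ht) hβ.le
  have h3 : f t - t * (α * p + β * q) = α * (f t - t * p) + β * (f t - t * q) := by
    subst hβ'; ring
  linarith

/-- If `g` is strictly monotone near `t`, the conjugate has derivative `-t` at `g t`. -/
lemma hasDerivAt_conj (h : ConvexDerivOn f g a b) {t : ℝ} (ht : t ∈ Ioo a b)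
    (hl : ∀ s ∈ Ioo a b, s < t → g s < g t) (hr : ∀ s ∈ Ioo a b, t < s → g t < g s) :
    HasDerivAt (concaveConj f a b) (-t) (g t) := by
  rw [hasDerivAt_iff_isLittleO, Asymptotics.isLittleO_iff]
  intro δ hδ
  obtain ⟨s₁, hs₁, hs₁t⟩ := exists_between (max_lt ht.1 (sub_lt_self t hδ))
  obtain ⟨s₂, hts₂, hs₂⟩ := exists_between (lt_min ht.2 (lt_add_of_pos_right t hδ))
  have m₁ : s₁ ∈ Ioo a b := ⟨(le_max_left _ _).trans_lt hs₁, hs₁t.trans ht.2⟩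
  have m₂ : s₂ ∈ Ioo a b := ⟨ht.1.trans hts₂, hs₂.trans_le (min_le_left _ _)⟩
  have e₁ : t - δ < s₁ := (le_max_right _ _).trans_lt hs₁
  have e₂ : s₂ < t + δ := hs₂.trans_le (min_le_right _ _)
  filter_upwards [Ioo_mem_nhds (hl s₁ m₁ hs₁t) (hr s₂ m₂ hts₂)] with z hz
  obtain ⟨u, hu, rfl⟩ := h.exists_deriv_eq m₁ m₂ hz.1 hz.2
  have u₁ := h.lt_of_deriv_lt m₁ hu hz.1
  have u₂ := h.lt_of_deriv_lt hu m₂ hz.2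
  have h1 := h.conj_le (g u) ht
  have h2 := h.conj_le (g t) hu
  have h3 := h.conj_deriv ht
  have h4 := h.conj_deriv hu
  rw [Real.norm_eq_abs, Real.norm_eq_abs, smul_eq_mul]
  have h5 : |t - u| ≤ δ := abs_le.2 ⟨by linarith, by linarith⟩
  have h6 : |(t - u) * (g u - g t)| ≤ δ * |g u - g t| := by
    rw [abs_mul]
    exact mul_le_mul_of_nonneg_right h5 (abs_nonneg _)
  refine (abs_le_abs_of_nonpos ?_ ?_).trans h6 <;> linarith

end ConvexDerivOn

/-! ### Convexity of the generalized log-moment generating function -/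

lemma elog_le_of_le_exp {c x : ℝ} (hc : 0 < c) {m : ENNReal}
    (hm : m ≤ ENNReal.ofReal (Real.exp (x / c))) : elog c m ≤ x := by
  have h := ENNReal.log_le_log hm
  rw [ENNReal.log_ofReal_of_pos (Real.exp_pos _), Real.log_exp] at h
  calc elog c m ≤ (c : EReal) * ((x / c : ℝ) : EReal) :=
        mul_le_mul_of_nonneg_left h (EReal.coe_nonneg.2 hc.le)
    _ = x := by rw [← EReal.coe_mul, mul_div_cancel₀ _ hc.ne']

lemma le_exp_of_elog_lt {c x : ℝ} (hc : 0 < c) {m : ENNReal} (hm : elog c m < x) :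
    m ≤ ENNReal.ofReal (Real.exp (x / c)) := by
  by_contra! hlt
  refine absurd hm (not_lt.2 ?_)
  have h := ENNReal.log_le_log hlt.le
  rw [ENNReal.log_ofReal_of_pos (Real.exp_pos _), Real.log_exp] at h
  calc (x : EReal) = (c : EReal) * ((x / c : ℝ) : EReal) := by
        rw [← EReal.coe_mul, mul_div_cancel₀ _ hc.ne']
    _ ≤ elog c m := mul_le_mul_of_nonneg_left h (EReal.coe_nonneg.2 hc.le)

/-- Convexity of an `EReal`-valued function, expressed through its strict epigraph. -/
def EConvex (L : ℝ → EReal) : Prop :=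
  ∀ s t x y α β : ℝ, L s < x → L t < y → 0 < α → 0 < β → α + β = 1 →
    L (α * s + β * t) ≤ ((α * x + β * y : ℝ) : EReal)

lemma eConvex_genLogMGF {ι : Type*} (lf : Filter ι) (μ : ι → Measure ℝ) (c : ι → ℝ)
    (hc : ∀ i, 0 < c i) : EConvex (genLogMGF lf μ c) := by
  intro s t x y α β hs ht hα hβ hαβ
  refine limsup_le_of_le (by isBoundedDefault) ?_
  filter_upwards [eventually_lt_of_limsup_lt hs, eventually_lt_of_limsup_lt ht] with i hi hj
  refine elog_le_of_le_exp (hc i) ?_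
  have h1 := le_exp_of_elog_lt (hc i) hi
  have h2 := le_exp_of_elog_lt (hc i) hj
  have key : ∀ u v : ℝ, ENNReal.ofReal (Real.exp (α * u + β * v)) =
      ENNReal.ofReal (Real.exp u) ^ α * ENNReal.ofReal (Real.exp v) ^ β := by
    intro u v
    rw [ENNReal.ofReal_rpow_of_pos (Real.exp_pos _), ENNReal.ofReal_rpow_of_pos (Real.exp_pos _),
      ← ENNReal.ofReal_mul (by positivity), ← Real.exp_mul, ← Real.exp_mul, ← Real.exp_add,
      mul_comm α, mul_comm β]
  calc ∫⁻ z : ℝ, ENNReal.ofReal (Real.exp ((α * s + β * t) * z / c i)) ∂(μ i)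
      = ∫⁻ z : ℝ, ENNReal.ofReal (Real.exp (s * z / c i)) ^ α *
          ENNReal.ofReal (Real.exp (t * z / c i)) ^ β ∂(μ i) := by
        refine lintegral_congr fun z => ?_
        rw [← key]
        congr 2
        ring
    _ ≤ _ := ENNReal.lintegral_mul_norm_pow_le
        (by fun_prop) (by fun_prop) hα.le hβ.le hαβ
    _ ≤ ENNReal.ofReal (Real.exp (x / c i)) ^ α * ENNReal.ofReal (Real.exp (y / c i)) ^ β := by
        gcongr
    _ = ENNReal.ofReal (Real.exp ((α * x + β * y) / c i)) := by
        rw [← key]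
        congr 2
        ring

lemma genLogMGF_zero {ι : Type*} (lf : Filter ι) [lf.NeBot] (μ : ι → Measure ℝ)
    [∀ i, IsProbabilityMeasure (μ i)] (c : ι → ℝ) : genLogMGF lf μ c 0 = 0 := by
  simp [genLogMGF, elog]

/-! ### One-sided limits -/

lemma rightLimE_eq {F : ℝ → EReal} {t : ℝ} {y : EReal} (h : Tendsto F (𝓝[>] t) (𝓝 y)) :
    rightLimE F t = y :=
  h.limsup_eq

lemma leftLimE_eq {F : ℝ → EReal} {t : ℝ} {y : EReal} (h : Tendsto F (𝓝[<] t) (𝓝 y)) :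
    leftLimE F t = y :=
  h.limsup_eq

/-! ### Convex functions finite on an interval -/

/-- `L` is convex, vanishes at `0`, and is differentiable on `(a, b)`, where `0 ≤ a < b`. -/
structure EConvexDiffOn (L : ℝ → EReal) (a b : ℝ) : Prop where
  convex : EConvex L
  zero : L 0 = 0
  nonneg : 0 ≤ a
  lt : a < b
  diff : ∀ t ∈ Ioo a b, EDifferentiableAt L t

lemma EConvex.le_of_between {L : ℝ → EReal} (hL : EConvex L) {s u t x y : ℝ} (hsu : s < u)
    (hut : u < t) (hx : L s < x) (hy : L t < y) :
    L u ≤ (((t - u) / (t - s) * x + (u - s) / (t - s) * y : ℝ) : EReal) := by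
  have h0 : 0 < t - s := by linarith
  have := hL s t x y ((t - u) / (t - s)) ((u - s) / (t - s)) hx hy
    (div_pos (by linarith) h0) (div_pos (by linarith) h0) (by field_simp; ring)
  convert this using 2
  field_simp
  ring

namespace EConvexDiffOn

variable {L : ℝ → EReal} {a b : ℝ}

lemma ne_bot (h : EConvexDiffOn L a b) {s : ℝ} (hs : 0 ≤ s) : L s ≠ ⊥ := by
  intro hbot
  have hs0 : 0 < s := by
    refine hs.lt_of_ne fun h0 => ?_
    rw [← h0, h.zero] at hbot
    exact EReal.zero_ne_bot hbot
  obtain ⟨u, hu1, hu2⟩ := exists_between h.lt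
  by_cases hsu : u < s
  · obtain ⟨⟨r, hr⟩, -⟩ := h.diff u ⟨hu1, hu2⟩
    have hu0 : 0 < u := h.nonneg.trans_lt hu1
    have hle := h.convex.le_of_between (x := 1) (y := (r - 1) * (s / u) - (s - u) / u) hu0 hsu
      (by rw [h.zero]; exact_mod_cast zero_lt_one) (by rw [hbot]; exact EReal.bot_lt_coe _)
    rw [hr, EReal.coe_le_coe_iff] at hle
    have : (s - u) / (s - 0) * 1 + (u - 0) / (s - 0) * ((r - 1) * (s / u) - (s - u) / u)
        = r - 1 := by
      simp only [sub_zero]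
      field_simp
      ring
    linarith
  · obtain ⟨v, hv1, hv2⟩ := exists_between hu2
    obtain ⟨w, hw1, hw2⟩ := exists_between hv1
    obtain ⟨⟨r, hr⟩, -⟩ := h.diff w ⟨hu1.trans hw1, hw2.trans (hv2)⟩
    obtain ⟨⟨q, hq⟩, -⟩ := h.diff v ⟨hu1.trans hv1, hv2⟩
    have hsw : s < w := (not_lt.1 hsu).trans_lt hw1
    have h1 : 0 < v - w := by linarith
    have h2 : 0 < v - s := by linarith
    have hle := h.convex.le_of_between
      (x := (r - 1 - (w - s) / (v - s) * (q + 1)) * ((v - s) / (v - w))) (y := q + 1) hsw hw2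
      (by rw [hbot]; exact EReal.bot_lt_coe _)
      (by rw [hq]; exact_mod_cast lt_add_one q)
    rw [hr, EReal.coe_le_coe_iff] at hle
    have : (v - w) / (v - s) * ((r - 1 - (w - s) / (v - s) * (q + 1)) * ((v - s) / (v - w))) +
        (w - s) / (v - s) * (q + 1) = r - 1 := by
      field_simp
      ring
    linarith

lemma ne_top (h : EConvexDiffOn L a b) {s : ℝ} (hs : 0 ≤ s) (hsb : s < b) : L s ≠ ⊤ := by
  rcases hs.eq_or_lt with rfl | hs0
  · rw [h.zero]
    exact EReal.zero_ne_top
  obtain ⟨u, hu1, hu2⟩ := exists_between (max_lt h.lt hsb)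
  obtain ⟨⟨r, hr⟩, -⟩ := h.diff u ⟨(le_max_left _ _).trans_lt hu1, hu2⟩
  have hle := h.convex.le_of_between (x := 1) (y := r + 1) hs0 ((le_max_right _ _).trans_lt hu1)
    (by rw [h.zero]; exact_mod_cast zero_lt_one) (by rw [hr]; exact_mod_cast lt_add_one r)
  exact (hle.trans_lt (EReal.coe_lt_top _)).ne

lemma coe_toReal (h : EConvexDiffOn L a b) {s : ℝ} (hs : s ∈ Ico 0 b) :
    ((L s).toReal : EReal) = L s :=
  EReal.coe_toReal (h.ne_top hs.1 hs.2) (h.ne_bot hs.1)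

lemma Ioo_subset (h : EConvexDiffOn L a b) : Ioo a b ⊆ Ico 0 b :=
  fun _ ht => ⟨h.nonneg.trans ht.1.le, ht.2⟩

lemma convexOn (h : EConvexDiffOn L a b) :
    ConvexOn ℝ {s | 0 ≤ s ∧ L s ≠ ⊤} (fun s => (L s).toReal) := by
  have key : ∀ s ∈ {s | 0 ≤ s ∧ L s ≠ ⊤}, ∀ t ∈ {s | 0 ≤ s ∧ L s ≠ ⊤}, ∀ α β δ : ℝ,
      0 < α → 0 < β → α + β = 1 → 0 < δ →
      L (α * s + β * t) ≤ ((α * (L s).toReal + β * (L t).toReal + δ : ℝ) : EReal) := by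
    intro s hs t ht α β δ hα hβ hαβ hδ
    have h1 : L s < (((L s).toReal + δ : ℝ) : EReal) := by
      rw [← EReal.coe_toReal hs.2 (h.ne_bot hs.1)]
      exact_mod_cast lt_add_of_pos_right _ hδ
    have h2 : L t < (((L t).toReal + δ : ℝ) : EReal) := by
      rw [← EReal.coe_toReal ht.2 (h.ne_bot ht.1)]
      exact_mod_cast lt_add_of_pos_right _ hδ
    refine (h.convex s t _ _ α β h1 h2 hα hβ hαβ).trans_eq ?_
    congr 1
    linear_combination δ * hαβ
  have mem : ∀ s ∈ {s | 0 ≤ s ∧ L s ≠ ⊤}, ∀ t ∈ {s | 0 ≤ s ∧ L s ≠ ⊤}, ∀ α β : ℝ,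
      0 < α → 0 < β → α + β = 1 → α * s + β * t ∈ {s | 0 ≤ s ∧ L s ≠ ⊤} := by
    intro s hs t ht α β hα hβ hαβ
    have := hs.1
    have := ht.1
    exact ⟨by positivity,
      ((key s hs t ht α β 1 hα hβ hαβ one_pos).trans_lt (EReal.coe_lt_top _)).ne⟩
  refine convexOn_iff_forall_pos.2 ⟨convex_iff_forall_pos.2 fun s hs t ht α β hα hβ hαβ =>
    mem s hs t ht α β hα hβ hαβ, fun s hs t ht α β hα hβ hαβ => ?_⟩
  simp only [smul_eq_mul]
  refine le_of_forall_pos_le_add fun δ hδ => ?_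
  have hm := mem s hs t ht α β hα hβ hαβ
  have := key s hs t ht α β δ hα hβ hαβ hδ
  rwa [← EReal.coe_toReal hm.2 (h.ne_bot hm.1), EReal.coe_le_coe_iff] at this

lemma quotient_eq_coe_slope (h : EConvexDiffOn L a b) {s t : ℝ} (hs : s ∈ Ico 0 b)
    (ht : t ∈ Ico 0 b) : (L s - L t) * (((s - t)⁻¹ : ℝ) : EReal) =
      ((slope (fun u => (L u).toReal) t s : ℝ) : EReal) := by
  rw [← h.coe_toReal hs, ← h.coe_toReal ht, slope_def_field, div_eq_mul_inv]
  simp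

lemma tendsto_quotient_iff (h : EConvexDiffOn L a b) {t d : ℝ} (ht : t ∈ Ioo 0 b) :
    Tendsto (fun s => (L s - L t) * (((s - t)⁻¹ : ℝ) : EReal)) (𝓝[≠] t) (𝓝 (d : EReal)) ↔
      HasDerivAt (fun u => (L u).toReal) d t := by
  rw [hasDerivAt_iff_tendsto_slope, ← EReal.tendsto_coe]
  refine tendsto_congr' ?_
  filter_upwards [mem_nhdsWithin_of_mem_nhds (Ioo_mem_nhds ht.1 ht.2)] with s hs
  exact h.quotient_eq_coe_slope ⟨hs.1.le, hs.2⟩ ⟨ht.1.le, ht.2⟩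

lemma eDifferentiableAt_iff (h : EConvexDiffOn L a b) {t : ℝ} (ht : t ∈ Ioo 0 b) :
    EDifferentiableAt L t ↔ ∃ d, HasDerivAt (fun u => (L u).toReal) d t := by
  simp only [EDifferentiableAt, h.tendsto_quotient_iff ht]
  exact and_iff_right ⟨_, (h.coe_toReal ⟨ht.1.le, ht.2⟩).symm⟩

lemma hasDerivAt (h : EConvexDiffOn L a b) {t : ℝ} (ht : t ∈ Ioo a b) :
    HasDerivAt (fun u => (L u).toReal) (deriv (fun u => (L u).toReal) t) t := by
  obtain ⟨d, hd⟩ := (h.eDifferentiableAt_iff ⟨h.nonneg.trans_lt ht.1, ht.2⟩).1 (h.diff t ht)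
  exact hd.differentiableAt.hasDerivAt

lemma mem_dom (h : EConvexDiffOn L a b) {t : ℝ} (ht : t ∈ Ico 0 b) :
    t ∈ {s | 0 ≤ s ∧ L s ≠ ⊤} :=
  ⟨ht.1, h.ne_top ht.1 ht.2⟩

/-- The graph of `L` lies above its tangents. -/
lemma tangent (h : EConvexDiffOn L a b) {s t : ℝ} (hs : s ∈ Ico 0 b) (ht : t ∈ Ioo a b) :
    (L t).toReal + deriv (fun u => (L u).toReal) t * (s - t) ≤ (L s).toReal := by
  have hd := h.hasDerivAt ht
  have htd := h.mem_dom (h.Ioo_subset ht)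
  rcases lt_trichotomy s t with hst | rfl | hst
  · have := h.convexOn.slope_le_of_hasDerivAt (h.mem_dom hs) htd hst hd
    rw [slope_def_field, div_le_iff₀ (by linarith)] at this
    linarith
  · simp
  · have := h.convexOn.le_slope_of_hasDerivAt htd (h.mem_dom hs) hst hd
    rw [slope_def_field, le_div_iff₀ (by linarith)] at this
    linarith

lemma convexDerivOn (h : EConvexDiffOn L a b) :
    ConvexDerivOn (fun u => (L u).toReal) (deriv fun u => (L u).toReal) a b where
  nonneg := h.nonneg
  lt := h.lt
  tangent _ hs _ ht := h.tangent (h.Ioo_subset hs) ht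
  hasDerivAt _ ht := h.hasDerivAt ht

lemma rightDerivE_eq (h : EConvexDiffOn L a b) {t : ℝ} (ht : t ∈ Ioo a b) :
    rightDerivE L t = ((deriv (fun u => (L u).toReal) t : ℝ) : EReal) := by
  have ht0 := h.Ioo_subset ht
  have hd := h.hasDerivAt ht
  rw [rightDerivE, if_neg, if_neg]
  · refine le_antisymm ?_ ?_
    · have hlim := EReal.tendsto_coe.2 <|
        (hasDerivAt_iff_tendsto_slope.1 hd).mono_left (nhdsGT_le_nhdsNE t)
      refine ge_of_tendsto hlim ?_
      filter_upwards [Ioo_mem_nhdsGT ht.2] with s hs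
      rw [← h.quotient_eq_coe_slope ⟨ht0.1.trans hs.1.le, hs.2⟩ ht0]
      exact iInf₂_le s hs.1
    · refine le_iInf₂ fun s hs => ?_
      rw [mem_Ioi] at hs
      have hpos : 0 < (s - t)⁻¹ := inv_pos.2 (sub_pos.2 hs)
      by_cases htop : L s = ⊤
      · rw [htop, ← h.coe_toReal ht0, EReal.top_sub_coe, EReal.top_mul_coe_of_pos hpos]
        exact le_top
      · have hs0 := ht0.1.trans hs.le
        have := h.convexOn.le_slope_of_hasDerivAt (h.mem_dom ht0) ⟨hs0, htop⟩ hs hd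
        rw [slope_def_field, div_eq_mul_inv] at this
        rw [← h.coe_toReal ht0, ← EReal.coe_toReal htop (h.ne_bot hs0)]
        exact_mod_cast this
  · rintro ⟨s, hs, hbot⟩
    exact h.ne_bot (ht0.1.trans hs.le) hbot
  · intro hall
    obtain ⟨s, hs1, hs2⟩ := exists_between ht.2
    exact h.ne_top (ht0.1.trans hs1.le) hs2 (hall s hs1)

end EConvexDiffOn

/-! ### The endpoint slopes -/

namespace ConvexDerivOn

variable {f g : ℝ → ℝ} {a b : ℝ}

lemma tendsto_right_endpoint (h : ConvexDerivOn f g a b) {m : ℝ} (hm : ∀ t ∈ Ioo a b, m ≤ g t) :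
    Tendsto f (𝓝[>] a) (𝓝 (concaveConj f a b m + a * m)) := by
  have hmono : MonotoneOn (fun t => f t - t * m) (Ioo a b) := by
    intro s hs t ht hst
    have h1 := h.tangent t ht s hs
    have h2 := mul_le_mul_of_nonneg_right (hm s hs) (sub_nonneg.2 hst)
    show f s - s * m ≤ f t - t * m
    linarith
  have h1 := hmono.tendsto_nhdsWithin_Ioo_right (nonempty_Ioo.2 h.lt) (h.bddBelow m)
  have h2 : Tendsto (fun t : ℝ => t * m) (𝓝[>] a) (𝓝 (a * m)) :=
    ((continuous_id.mul continuous_const).tendsto a).mono_left nhdsWithin_le_nhds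
  simpa [concaveConj] using! h1.add h2

end ConvexDerivOn

namespace EConvexDiffOn

variable {L : ℝ → EReal} {a b : ℝ}

lemma monotoneOn_coe_deriv (h : EConvexDiffOn L a b) :
    MonotoneOn (fun t => ((deriv (fun u => (L u).toReal) t : ℝ) : EReal)) (Ioo a b) :=
  fun _ hs _ ht hst => EReal.coe_le_coe_iff.2 (h.convexDerivOn.monotoneOn hs ht hst)

lemma rightDerivE_eventuallyEq (h : EConvexDiffOn L a b) {l : Filter ℝ} (hl : Ioo a b ∈ l) :
    rightDerivE L =ᶠ[l] fun t => ((deriv (fun u => (L u).toReal) t : ℝ) : EReal) := by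
  filter_upwards [hl] with t ht using h.rightDerivE_eq ht

lemma rightLimE_eq_sInf (h : EConvexDiffOn L a b) : rightLimE (rightDerivE L) a =
    sInf ((fun t => ((deriv (fun u => (L u).toReal) t : ℝ) : EReal)) '' Ioo a b) :=
  rightLimE_eq <| (h.monotoneOn_coe_deriv.tendsto_nhdsWithin_Ioo_right (nonempty_Ioo.2 h.lt)
    (OrderBot.bddBelow _)).congr' (h.rightDerivE_eventuallyEq (Ioo_mem_nhdsGT h.lt)).symm

lemma leftLimE_eq_sSup (h : EConvexDiffOn L a b) : leftLimE (rightDerivE L) b =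
    sSup ((fun t => ((deriv (fun u => (L u).toReal) t : ℝ) : EReal)) '' Ioo a b) :=
  leftLimE_eq <| (h.monotoneOn_coe_deriv.tendsto_nhdsWithin_Ioo_left (nonempty_Ioo.2 h.lt)
    (OrderTop.bddAbove _)).congr' (h.rightDerivE_eventuallyEq (Ioo_mem_nhdsLT h.lt)).symm

lemma tendsto_deriv (h : EConvexDiffOn L a b) :
    Tendsto (fun t => ((deriv (fun u => (L u).toReal) t : ℝ) : EReal)) (𝓝[>] a)
      (𝓝 (rightLimE (rightDerivE L) a)) := by
  rw [h.rightLimE_eq_sInf]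
  exact h.monotoneOn_coe_deriv.tendsto_nhdsWithin_Ioo_right (nonempty_Ioo.2 h.lt)
    (OrderBot.bddBelow _)

lemma rightLimE_le (h : EConvexDiffOn L a b) {t : ℝ} (ht : t ∈ Ioo a b) :
    rightLimE (rightDerivE L) a ≤ ((deriv (fun u => (L u).toReal) t : ℝ) : EReal) := by
  rw [h.rightLimE_eq_sInf]
  exact sInf_le (mem_image_of_mem _ ht)

lemma le_leftLimE (h : EConvexDiffOn L a b) {t : ℝ} (ht : t ∈ Ioo a b) :
    ((deriv (fun u => (L u).toReal) t : ℝ) : EReal) ≤ leftLimE (rightDerivE L) b := by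
  rw [h.leftLimE_eq_sSup]
  exact le_sSup (mem_image_of_mem _ ht)

lemma exists_deriv_lt (h : EConvexDiffOn L a b) {z : EReal}
    (hz : rightLimE (rightDerivE L) a < z) :
    ∃ t ∈ Ioo a b, ((deriv (fun u => (L u).toReal) t : ℝ) : EReal) < z := by
  rw [h.rightLimE_eq_sInf, sInf_lt_iff] at hz
  obtain ⟨_, ⟨t, ht, rfl⟩, hlt⟩ := hz
  exact ⟨t, ht, hlt⟩

lemma exists_lt_deriv (h : EConvexDiffOn L a b) {z : EReal}
    (hz : z < leftLimE (rightDerivE L) b) :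
    ∃ t ∈ Ioo a b, z < ((deriv (fun u => (L u).toReal) t : ℝ) : EReal) := by
  rw [h.leftLimE_eq_sSup, lt_sSup_iff] at hz
  obtain ⟨_, ⟨t, ht, rfl⟩, hlt⟩ := hz
  exact ⟨t, ht, hlt⟩

lemma exists_deriv_eq (h : EConvexDiffOn L a b) {z : ℝ}
    (hz : rightLimE (rightDerivE L) a < z) (hz' : z < leftLimE (rightDerivE L) b) :
    ∃ t ∈ Ioo a b, deriv (fun u => (L u).toReal) t = z := by
  obtain ⟨s, hs, hsz⟩ := h.exists_deriv_lt hz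
  obtain ⟨t, ht, hzt⟩ := h.exists_lt_deriv hz'
  exact h.convexDerivOn.exists_deriv_eq hs ht (EReal.coe_lt_coe_iff.1 hsz)
    (EReal.coe_lt_coe_iff.1 hzt)

lemma rightLimE_rightDerivE (h : EConvexDiffOn L a b)
    (hsup : ∀ t ∈ Ioo a b, ∃ s ∈ Ioo a b, rightDerivE L t < rightDerivE L s)
    {t : ℝ} (ht : t ∈ Ioo a b) :
    rightLimE (rightDerivE L) t = ((deriv (fun u => (L u).toReal) t : ℝ) : EReal) := by
  refine rightLimE_eq ?_
  have hlim := EReal.tendsto_coe.2 (h.convexDerivOn.tendsto_deriv_right (fun t ht => ?_) ht)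
  · refine hlim.congr' (h.rightDerivE_eventuallyEq ?_).symm
    exact mem_nhdsWithin_of_mem_nhds (Ioo_mem_nhds ht.1 ht.2)
  · obtain ⟨s, hs, hlt⟩ := hsup t ht
    rw [h.rightDerivE_eq ht, h.rightDerivE_eq hs, EReal.coe_lt_coe_iff] at hlt
    exact ⟨s, hs, hlt⟩

lemma tendsto_nhdsGT_iff (h : EConvexDiffOn L a b) {t y : ℝ} (ht : t ∈ Ico a b) :
    Tendsto L (𝓝[>] t) (𝓝 (y : EReal)) ↔
      Tendsto (fun u => (L u).toReal) (𝓝[>] t) (𝓝 y) := by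
  rw [← EReal.tendsto_coe]
  refine tendsto_congr' ?_
  filter_upwards [Ioo_mem_nhdsGT ht.2] with s hs
  exact (h.coe_toReal ⟨h.nonneg.trans (ht.1.trans hs.1.le), hs.2⟩).symm

lemma rightLimE_self (h : EConvexDiffOn L a b) {t : ℝ} (ht : t ∈ Ioo a b) :
    rightLimE L t = (((L t).toReal : ℝ) : EReal) :=
  rightLimE_eq <| (h.tendsto_nhdsGT_iff ⟨ht.1.le, ht.2⟩).2 <|
    (h.hasDerivAt ht).continuousAt.tendsto.mono_left nhdsWithin_le_nhds

lemma toReal_zero (h : EConvexDiffOn L a b) : (L 0).toReal = 0 := by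
  simp [h.zero]

lemma mem_zero (h : EConvexDiffOn L a b) : (0 : ℝ) ∈ Ico 0 b :=
  ⟨le_rfl, h.nonneg.trans_lt h.lt⟩

lemma eq_zero_of_rightLimE_eq_bot (h : EConvexDiffOn L a b)
    (hbot : rightLimE (rightDerivE L) a = ⊥) : a = 0 := by
  by_contra hne
  have ha : 0 < a := h.nonneg.lt_of_ne' hne
  have ha' : a ∈ Ico 0 b := ⟨ha.le, h.lt⟩
  obtain ⟨t, ht, hlt⟩ := h.exists_deriv_lt (z := ((((L a).toReal / a : ℝ)) : EReal))
    (by rw [hbot]; exact EReal.bot_lt_coe _)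
  rw [EReal.coe_lt_coe_iff, lt_div_iff₀ ha] at hlt
  have h1 := h.tangent ha' ht
  have h2 := h.convexOn.slope_mono_adjacent (h.mem_dom h.mem_zero)
    (h.mem_dom (h.Ioo_subset ht)) ha ht.1
  have hat : 0 < t - a := sub_pos.2 ht.1
  rw [h.toReal_zero, sub_zero, sub_zero, div_le_div_iff₀ ha hat] at h2
  nlinarith

lemma conj_nonpos (h : EConvexDiffOn L a b) {z : ℝ}
    (hz : rightLimE (rightDerivE L) a ≤ z) :
    concaveConj (fun u => (L u).toReal) a b z ≤ 0 := by
  have hg : ∀ t ∈ Ioo a b, concaveConj (fun u => (L u).toReal) a b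
      (deriv (fun u => (L u).toReal) t) ≤ 0 := by
    intro t ht
    rw [h.convexDerivOn.conj_deriv ht]
    have := h.tangent h.mem_zero ht
    rw [h.toReal_zero] at this
    linarith
  rcases hz.eq_or_lt with heq | hlt
  · have hlim := h.tendsto_deriv
    rw [heq, EReal.tendsto_coe] at hlim
    refine le_of_tendsto ((h.convexDerivOn.conj_continuous.tendsto z).comp hlim) ?_
    filter_upwards [Ioo_mem_nhdsGT h.lt] with t ht using hg t ht
  · obtain ⟨t, ht, htz⟩ := h.exists_deriv_lt hlt
    exact (h.convexDerivOn.conj_antitone (EReal.coe_lt_coe_iff.1 htz).le).trans (hg t ht)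

lemma tendsto_endpoint (h : EConvexDiffOn L a b) {m : ℝ}
    (hm : rightLimE (rightDerivE L) a = m) :
    Tendsto (fun u => (L u).toReal) (𝓝[>] a)
      (𝓝 (concaveConj (fun u => (L u).toReal) a b m + a * m)) :=
  h.convexDerivOn.tendsto_right_endpoint fun t ht => by
    have := h.rightLimE_le ht
    rwa [hm, EReal.coe_le_coe_iff] at this

lemma continuousAt_endpoint (h : EConvexDiffOn L a b) (ha : 0 < a) :
    ContinuousAt (fun u => (L u).toReal) a := by
  have hsub : Ioo 0 b ⊆ {s | 0 ≤ s ∧ L s ≠ ⊤} := fun s hs => h.mem_dom ⟨hs.1.le, hs.2⟩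
  exact ((h.convexOn.subset hsub (convex_Ioo 0 b)).continuousOn isOpen_Ioo).continuousAt
    (Ioo_mem_nhds ha h.lt)

lemma hasDerivWithinAt_endpoint (h : EConvexDiffOn L a b) (ha : 0 < a) {m : ℝ}
    (hm : rightLimE (rightDerivE L) a = m) :
    HasDerivWithinAt (fun u => (L u).toReal) m (Ici a) a := by
  have hlim := h.tendsto_deriv
  rw [hm, EReal.tendsto_coe] at hlim
  exact hasDerivWithinAt_Ici_of_tendsto_deriv
    (fun t ht => (h.hasDerivAt ht).differentiableAt.differentiableWithinAt)
    (h.continuousAt_endpoint ha).continuousWithinAt (Ioo_mem_nhdsGT h.lt) hlim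

lemma conj_endpoint (h : EConvexDiffOn L a b) (ha : 0 < a) {m : ℝ}
    (hm : rightLimE (rightDerivE L) a = m) :
    concaveConj (fun u => (L u).toReal) a b m = (L a).toReal - a * m := by
  have := tendsto_nhds_unique (h.tendsto_endpoint hm)
    ((h.continuousAt_endpoint ha).tendsto.mono_left nhdsWithin_le_nhds)
  linarith

/-- At a positive endpoint, the conjugate vanishes at the slope iff `L` is differentiable at the
endpoint and linear up to it. -/
lemma conj_eq_zero_iff_of_pos (h : EConvexDiffOn L a b) (ha : 0 < a) {m : ℝ}
    (hm : rightLimE (rightDerivE L) a = m) :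
    concaveConj (fun u => (L u).toReal) a b m = 0 ↔
      EDifferentiableAt L a ∧ ∃ p : ℝ, ∀ s ∈ Icc (0 : ℝ) a, L s = ((p * s : ℝ) : EReal) := by
  have ha' : a ∈ Ioo 0 b := ⟨ha, h.lt⟩
  have hright := h.hasDerivWithinAt_endpoint ha hm
  have hleft : ∀ p : ℝ, (∀ s ∈ Icc (0 : ℝ) a, L s = ((p * s : ℝ) : EReal)) →
      HasDerivWithinAt (fun u => (L u).toReal) p (Iic a) a := by
    intro p hp
    have hlin : HasDerivWithinAt (fun u : ℝ => p * u) p (Iic a) a := by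
      simpa using ((hasDerivAt_id a).const_mul p).hasDerivWithinAt
    refine hlin.congr_of_eventuallyEq ?_ ?_
    · filter_upwards [Ioc_mem_nhdsLE ha] with s hs
      rw [hp s ⟨hs.1.le, hs.2⟩, EReal.toReal_coe]
    · rw [hp a ⟨ha.le, le_rfl⟩, EReal.toReal_coe]
  rw [h.conj_endpoint ha hm]
  constructor
  · intro h0
    have hlin : ∀ s ∈ Icc (0 : ℝ) a, L s = ((m * s : ℝ) : EReal) := by
      intro s hs
      have hs' : s ∈ Ico 0 b := ⟨hs.1, hs.2.trans_lt h.lt⟩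
      rw [← h.coe_toReal hs', EReal.coe_eq_coe_iff]
      refine le_antisymm ?_ ?_
      · have hcv := h.convexOn.2 (h.mem_dom h.mem_zero) (h.mem_dom ⟨ha.le, h.lt⟩)
          (sub_nonneg.2 ((div_le_one ha).2 hs.2)) (div_nonneg hs.1 ha.le) (sub_add_cancel _ _)
        simp only [smul_eq_mul, h.toReal_zero, mul_zero, zero_add] at hcv
        rw [div_mul_cancel₀ _ ha.ne', show (L a).toReal = a * m by linarith] at hcv
        refine hcv.trans_eq ?_
        field_simp
      · have hlim := h.tendsto_deriv
        rw [hm, EReal.tendsto_coe] at hlim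
        have hcont : Tendsto (fun u => (L u).toReal) (𝓝[>] a) (𝓝 (L a).toReal) :=
          (h.continuousAt_endpoint ha).tendsto.mono_left nhdsWithin_le_nhds
        have hid : Tendsto (fun u : ℝ => s - u) (𝓝[>] a) (𝓝 (s - a)) :=
          ((continuous_const.sub continuous_id).tendsto a).mono_left nhdsWithin_le_nhds
        have := le_of_tendsto (hcont.add (hlim.mul hid)) (b := (L s).toReal) (by
          filter_upwards [Ioo_mem_nhdsGT h.lt] with t ht using h.tangent hs' ht)
        linarith
    refine ⟨(h.eDifferentiableAt_iff ha').2 ⟨m, ?_⟩, m, hlin⟩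
    have := (hleft m hlin).union hright
    rwa [Iic_union_Ici, hasDerivWithinAt_univ] at this
  · rintro ⟨hd, p, hp⟩
    obtain ⟨d, hd⟩ := (h.eDifferentiableAt_iff ha').1 hd
    have h1 : d = m := (uniqueDiffWithinAt_Ici a).eq_deriv _ hd.hasDerivWithinAt hright
    have h2 : d = p := (uniqueDiffWithinAt_Iic a).eq_deriv _ hd.hasDerivWithinAt (hleft p hp)
    rw [hp a ⟨ha.le, le_rfl⟩, EReal.toReal_coe, ← h1, ← h2]
    ring

end EConvexDiffOn

/-! ### Differentiability of the conjugate -/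

namespace EConvexDiffOn

variable {L : ℝ → EReal} {a b : ℝ}

lemma exists_deriv_eq_of_affineOnIoc {L : ℝ → EReal} {a t : ℝ} (b : ℝ)
    (haff : AffineOnIoc L a t) :
    ∃ p : ℝ, ∀ s ∈ Ioo a (min t b), deriv (fun u => (L u).toReal) s = p := by
  obtain ⟨p, q, hpq⟩ := haff
  refine ⟨p, fun s hs => ?_⟩
  have heq : (fun u => (L u).toReal) =ᶠ[𝓝 s] fun u => p * u + q := by
    filter_upwards [Ioo_mem_nhds hs.1 hs.2] with u hu
    rw [hpq u ⟨hu.1, (hu.2.trans_le (min_le_left _ _)).le⟩, EReal.toReal_coe]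
  rw [heq.deriv_eq]
  simp

lemma tildeOf_bddAbove (h : EConvexDiffOn L a b)
    (hsup : ∀ t ∈ Ioo a b, ∃ s ∈ Ioo a b, rightDerivE L t < rightDerivE L s) :
    BddAbove (insert a {t : ℝ | a < t ∧ AffineOnIoc L a t}) := by
  refine ⟨b, ?_⟩
  rintro t (rfl | ⟨-, haff⟩)
  · exact h.lt.le
  by_contra! hbt
  obtain ⟨p, hp⟩ := exists_deriv_eq_of_affineOnIoc b haff
  rw [min_eq_right hbt.le] at hp
  obtain ⟨s, hs⟩ := nonempty_Ioo.2 h.lt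
  obtain ⟨u, hu, hlt⟩ := hsup s hs
  rw [h.rightDerivE_eq hs, h.rightDerivE_eq hu, hp s hs, hp u hu] at hlt
  exact lt_irrefl _ hlt

/-- A point whose slope exceeds the endpoint slope lies to the right of `tildeOf L a`. -/
lemma tildeOf_lt (h : EConvexDiffOn L a b) {t : ℝ} (ht : t ∈ Ioo a b)
    (hslope : rightLimE (rightDerivE L) a < ((deriv (fun u => (L u).toReal) t : ℝ) : EReal)) :
    tildeOf L a < t := by
  by_contra! hle
  obtain ⟨w, hmw, hwt⟩ := EReal.lt_iff_exists_real_btwn.1 hslope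
  obtain ⟨v, hv, rfl⟩ := h.exists_deriv_eq hmw (hwt.trans_le (h.le_leftLimE ht))
  have hvt := h.convexDerivOn.lt_of_deriv_lt hv ht (EReal.coe_lt_coe_iff.1 hwt)
  obtain ⟨u, hu, hvu⟩ := exists_lt_of_lt_csSup (insert_nonempty _ _) (hvt.trans_le hle)
  rcases hu with rfl | ⟨hau, haff⟩
  · exact absurd hv.1 (not_lt.2 hvu.le)
  obtain ⟨p, hp⟩ := exists_deriv_eq_of_affineOnIoc b haff
  have hlim : Tendsto (fun s => ((deriv (fun u => (L u).toReal) s : ℝ) : EReal)) (𝓝[>] a)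
      (𝓝 (p : EReal)) := by
    refine tendsto_const_nhds.congr' ?_
    filter_upwards [Ioo_mem_nhdsGT (lt_min hau h.lt)] with s hs
    rw [hp s hs]
  rw [tendsto_nhds_unique h.tendsto_deriv hlim, hp v ⟨hv.1, lt_min hvu hv.2⟩] at hmw
  exact lt_irrefl _ hmw

lemma deriv_lt_of_strictConvex (h : EConvexDiffOn L a b) {s t : ℝ} (hs : s ∈ Ioo a b)
    (ht : t ∈ Ioo a b) (hst : s < t)
    (hstrict : L (2⁻¹ * s + 2⁻¹ * t) <
      ((2⁻¹ : ℝ) : EReal) * L s + ((2⁻¹ : ℝ) : EReal) * L t) :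
    deriv (fun u => (L u).toReal) s < deriv (fun u => (L u).toReal) t := by
  have hmid : 2⁻¹ * s + 2⁻¹ * t ∈ Ioo a b :=
    ⟨by linarith [hs.1], by linarith [ht.2]⟩
  have hm := h.Ioo_subset hmid
  have h1 := h.tangent hm hs
  have h2 := h.tangent hm ht
  rw [← h.coe_toReal hm, ← h.coe_toReal (h.Ioo_subset hs),
    ← h.coe_toReal (h.Ioo_subset ht)] at hstrict
  have h3 : (L (2⁻¹ * s + 2⁻¹ * t)).toReal < 2⁻¹ * (L s).toReal + 2⁻¹ * (L t).toReal := by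
    exact_mod_cast hstrict
  by_contra! hc
  nlinarith

lemma differentiableAt_conj (h : EConvexDiffOn L a b)
    (hsup : ∀ t ∈ Ioo a b, ∃ s ∈ Ioo a b, rightDerivE L t < rightDerivE L s)
    (hstrict : ∀ s ∈ Ioo (tildeOf L a) b, ∀ t ∈ Ioo (tildeOf L a) b, s ≠ t →
      L (2⁻¹ * s + 2⁻¹ * t) < ((2⁻¹ : ℝ) : EReal) * L s + ((2⁻¹ : ℝ) : EReal) * L t)
    {p : ℝ} (hp : rightLimE (rightDerivE L) a < p) (hp' : p < leftLimE (rightDerivE L) b) :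
    DifferentiableAt ℝ (concaveConj (fun u => (L u).toReal) a b) p := by
  obtain ⟨t, ht, rfl⟩ := h.exists_deriv_eq hp hp'
  have htilde := h.tildeOf_lt ht hp
  have ha : a ≤ tildeOf L a := le_csSup (h.tildeOf_bddAbove hsup) (mem_insert _ _)
  have hmono : ∀ s u, tildeOf L a < s → s < u → u < b →
      deriv (fun u => (L u).toReal) s < deriv (fun u => (L u).toReal) u := by
    intro s u hs hsu hu
    exact h.deriv_lt_of_strictConvex ⟨ha.trans_lt hs, hsu.trans hu⟩
      ⟨ha.trans_lt (hs.trans hsu), hu⟩ hsu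
      (hstrict s ⟨hs, hsu.trans hu⟩ u ⟨hs.trans hsu, hu⟩ hsu.ne)
  refine (h.convexDerivOn.hasDerivAt_conj ht (fun s hs hst => ?_)
    fun s hs hts => hmono t s htilde hts hs.2).differentiableAt
  obtain ⟨v, hv1, hv2⟩ := exists_between (max_lt hst htilde)
  have hsv := (le_max_left _ _).trans_lt hv1
  exact (h.convexDerivOn.monotoneOn hs ⟨hs.1.trans hsv, hv2.trans ht.2⟩ hsv.le).trans_lt
    (hmono v t ((le_max_right _ _).trans_lt hv1) hv2 ht.2)

end EConvexDiffOn

/-! ### The conjugate on extended real slopes -/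

open Classical in
/-- The concave conjugate at extended real slopes, with value `0` at `-∞`. -/
noncomputable def concaveConjE (L : ℝ → EReal) (a b : ℝ) (z : EReal) : ℝ :=
  if z = ⊥ then 0 else concaveConj (fun u => (L u).toReal) a b z.toReal

@[simp]
lemma concaveConjE_bot (L : ℝ → EReal) (a b : ℝ) : concaveConjE L a b ⊥ = 0 :=
  if_pos rfl

@[simp]
lemma concaveConjE_coe (L : ℝ → EReal) (a b z : ℝ) :
    concaveConjE L a b z = concaveConj (fun u => (L u).toReal) a b z := by
  rw [concaveConjE, if_neg (EReal.coe_ne_bot z), EReal.toReal_coe]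

lemma eq_bot_or_coe_of_lt {z y : EReal} (hz : z < y) : z = ⊥ ∨ ∃ r : ℝ, z = r := by
  induction z with
  | bot => exact Or.inl rfl
  | coe r => exact Or.inr ⟨r, rfl⟩
  | top => exact absurd hz not_top_lt

namespace EConvexDiffOn

variable {L : ℝ → EReal} {a b : ℝ}

lemma concaveConjE_nonpos (h : EConvexDiffOn L a b) {z : EReal}
    (hz : rightLimE (rightDerivE L) a ≤ z) (hz' : z < leftLimE (rightDerivE L) b) :
    concaveConjE L a b z ≤ 0 := by
  rcases eq_bot_or_coe_of_lt hz' with rfl | ⟨r, rfl⟩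
  · simp
  · simpa using h.conj_nonpos hz

lemma concaveConjE_lt (h : EConvexDiffOn L a b) {z z' : EReal}
    (hz : rightLimE (rightDerivE L) a ≤ z) (hzz' : z < z')
    (hz' : z' < leftLimE (rightDerivE L) b) :
    concaveConjE L a b z' < concaveConjE L a b z := by
  rcases eq_bot_or_coe_of_lt hz' with rfl | ⟨r', rfl⟩
  · exact absurd hzz' not_lt_bot
  obtain ⟨w, hw, hw'⟩ := EReal.lt_iff_exists_real_btwn.1 hzz'
  obtain ⟨t, ht, rfl⟩ := h.exists_deriv_eq (hz.trans_lt hw) (hw'.trans hz')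
  have hlt := h.convexDerivOn.conj_lt_conj ht (EReal.coe_lt_coe_iff.1 hw')
  rw [concaveConjE_coe]
  rcases eq_bot_or_coe_of_lt hzz' with rfl | ⟨r, rfl⟩
  · rw [concaveConjE_bot]
    exact hlt.trans_le (h.conj_nonpos (h.rightLimE_le ht))
  · rw [concaveConjE_coe]
    exact hlt.trans_le (h.convexDerivOn.conj_antitone (EReal.coe_lt_coe_iff.1 hw).le)

lemma concaveConjE_eq (h : EConvexDiffOn L a b)
    (hsup : ∀ t ∈ Ioo a b, ∃ s ∈ Ioo a b, rightDerivE L t < rightDerivE L s)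
    (hbot : rightLimE (rightDerivE L) a = ⊥ → Tendsto L (𝓝[>] a) (𝓝 0))
    {z : EReal} (hz : z < leftLimE (rightDerivE L) b) {t : ℝ} (ht : t ∈ Ico a b)
    (htz : rightLimE (rightDerivE L) t = z) :
    ((concaveConjE L a b z : ℝ) : EReal) = rightLimE L t - (t : EReal) * z := by
  rcases ht.1.eq_or_lt with rfl | hat
  · rcases eq_bot_or_coe_of_lt hz with rfl | ⟨r, rfl⟩
    · rw [rightLimE_eq (hbot htz), h.eq_zero_of_rightLimE_eq_bot htz]
      simp
    · rw [rightLimE_eq ((h.tendsto_nhdsGT_iff ht).2 (h.tendsto_endpoint htz)), concaveConjE_coe,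
        ← EReal.coe_mul, ← EReal.coe_sub, add_sub_cancel_right]
  · have ht' : t ∈ Ioo a b := ⟨hat, ht.2⟩
    rw [h.rightLimE_rightDerivE hsup ht'] at htz
    rw [← htz, concaveConjE_coe, h.convexDerivOn.conj_deriv ht', h.rightLimE_self ht']
    simp

lemma continuousOn_concaveConjE (h : EConvexDiffOn L a b)
    (hbot : rightLimE (rightDerivE L) a = ⊥ → Tendsto L (𝓝[>] a) (𝓝 0)) :
    ContinuousOn (concaveConjE L a b)
      {z | rightLimE (rightDerivE L) a ≤ z ∧ z < leftLimE (rightDerivE L) b} := by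
  intro z hz
  rcases eq_bot_or_coe_of_lt hz.2 with rfl | ⟨r, rfl⟩
  · have hm : rightLimE (rightDerivE L) a = ⊥ := le_bot_iff.1 hz.1
    have hf : Tendsto (fun u => (L u).toReal) (𝓝[>] a) (𝓝 0) :=
      (h.tendsto_nhdsGT_iff ⟨le_rfl, h.lt⟩).1 (by simpa using hbot hm)
    rw [ContinuousWithinAt, concaveConjE_bot]
    refine tendsto_order.2 ⟨fun l hl => ?_, fun u hu => ?_⟩
    · have hneg : ∀ᶠ t in 𝓝[>] a,
          ((deriv (fun u => (L u).toReal) t : ℝ) : EReal) < ((0 : ℝ) : EReal) :=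
        h.tendsto_deriv.eventually_lt_const (by rw [hm]; exact EReal.bot_lt_coe _)
      obtain ⟨t, hlt, ht0, ht⟩ := ((hf.eventually_const_lt hl).and
        (hneg.and (Ioo_mem_nhdsGT h.lt))).exists
      rw [EReal.coe_lt_coe_iff] at ht0
      have hpos : 0 < t := h.nonneg.trans_lt ht.1
      have hconj := h.convexDerivOn.conj_deriv ht
      have hl' : l < concaveConj (fun u => (L u).toReal) a b
          (deriv (fun u => (L u).toReal) t) := by nlinarith
      filter_upwards [self_mem_nhdsWithin, mem_nhdsWithin_of_mem_nhds
        (Iio_mem_nhds (EReal.bot_lt_coe (deriv (fun u => (L u).toReal) t)))] with w hw hwt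
      rcases eq_bot_or_coe_of_lt hw.2 with rfl | ⟨q, rfl⟩
      · simpa using hl
      · rw [concaveConjE_coe]
        exact hl'.trans_le (h.convexDerivOn.conj_antitone (EReal.coe_lt_coe_iff.1 hwt).le)
    · filter_upwards [self_mem_nhdsWithin] with w hw
      exact (h.concaveConjE_nonpos hw.1 hw.2).trans_lt hu
  · refine ContinuousAt.continuousWithinAt ?_
    have hcont : ContinuousAt
        (fun w : EReal => concaveConj (fun u => (L u).toReal) a b w.toReal) (r : EReal) :=
      h.convexDerivOn.conj_continuous.continuousAt.comp
        (EReal.tendsto_toReal (EReal.coe_ne_top r) (EReal.coe_ne_bot r))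
    refine hcont.congr ?_
    filter_upwards [isOpen_ne.mem_nhds (EReal.coe_ne_bot r)] with w hw
    exact (if_neg hw).symm

lemma not_bddBelow_concaveConjE_iff (h : EConvexDiffOn L a b) :
    ¬ BddBelow (concaveConjE L a b ''
      {z | rightLimE (rightDerivE L) a ≤ z ∧ z < leftLimE (rightDerivE L) b}) ↔
      leftLimE (rightDerivE L) b = ⊤ := by
  obtain ⟨t, ht⟩ := h.convexDerivOn.exists_mem
  constructor
  · contrapose!
    intro hne
    have hcoe := EReal.coe_toReal hne
      ((EReal.bot_lt_coe _).trans_le (h.le_leftLimE ht)).ne'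
    refine ⟨min 0 (concaveConj (fun u => (L u).toReal) a b
      (leftLimE (rightDerivE L) b).toReal), ?_⟩
    rintro _ ⟨z, hz, rfl⟩
    rcases eq_bot_or_coe_of_lt hz.2 with rfl | ⟨r, rfl⟩
    · simp
    · rw [concaveConjE_coe]
      have hr := hz.2
      rw [← hcoe, EReal.coe_lt_coe_iff] at hr
      exact (min_le_right _ _).trans (h.convexDerivOn.conj_antitone hr.le)
  · rintro htop ⟨B, hB⟩
    have hpos : 0 < t := h.nonneg.trans_lt ht.1
    have hz : ((max (deriv (fun u => (L u).toReal) t) (((L t).toReal - B) / t + 1) : ℝ) : EReal) ∈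
        {z | rightLimE (rightDerivE L) a ≤ z ∧ z < leftLimE (rightDerivE L) b} :=
      ⟨(h.rightLimE_le ht).trans (EReal.coe_le_coe_iff.2 (le_max_left _ _)),
        by rw [htop]; exact EReal.coe_lt_top _⟩
    have h1 := hB (mem_image_of_mem _ hz)
    rw [concaveConjE_coe] at h1
    have h2 := h1.trans (h.convexDerivOn.conj_le _ ht)
    have h3 := mul_le_mul_of_nonneg_left
      (le_max_right (deriv (fun u => (L u).toReal) t) (((L t).toReal - B) / t + 1)) hpos.le
    rw [mul_add, mul_div_cancel₀ _ hpos.ne'] at h3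
    linarith

lemma concaveConjE_endpoint_eq_zero_iff (h : EConvexDiffOn L a b)
    (hbot : rightLimE (rightDerivE L) a = ⊥ → Tendsto L (𝓝[>] a) (𝓝 0)) :
    concaveConjE L a b (rightLimE (rightDerivE L) a) = 0 ↔
      ((0 < a ∧ EDifferentiableAt L a ∧
          ∃ p : ℝ, ∀ s ∈ Icc (0 : ℝ) a, L s = ((p * s : ℝ) : EReal)) ∨
        (a = 0 ∧ Tendsto L (𝓝[>] 0) (𝓝 0))) := by
  obtain ⟨t, ht⟩ := h.convexDerivOn.exists_mem
  rcases eq_bot_or_coe_of_lt ((h.rightLimE_le ht).trans_lt (EReal.coe_lt_top _)) with hm | ⟨m, hm⟩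
  · have ha := h.eq_zero_of_rightLimE_eq_bot hm
    have hlim := hbot hm
    rw [ha] at hlim
    rw [hm, concaveConjE_bot]
    exact iff_of_true rfl (Or.inr ⟨ha, hlim⟩)
  · rw [hm, concaveConjE_coe]
    rcases h.nonneg.eq_or_lt with ha | ha
    · have hlim := (h.tendsto_nhdsGT_iff ⟨le_rfl, h.lt⟩).2 (h.tendsto_endpoint hm)
      rw [← ha, zero_mul, add_zero] at hlim
      rw [← ha]
      simp only [lt_irrefl, false_and, true_and, false_or]
      constructor
      · intro h0
        simpa [h0] using hlim
      · intro h0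
        exact_mod_cast tendsto_nhds_unique hlim h0
    · rw [h.conj_eq_zero_iff_of_pos ha hm]
      simp [ha, ha.ne']

lemma strictConcaveOn_concaveConjE (h : EConvexDiffOn L a b) :
    StrictConcaveOn ℝ {p : ℝ | rightLimE (rightDerivE L) a < (p : EReal) ∧
      (p : EReal) < leftLimE (rightDerivE L) b} (fun p : ℝ => concaveConjE L a b p) := by
  simp only [concaveConjE_coe]
  refine h.convexDerivOn.strictConcaveOn_conj ?_ fun p hp => h.exists_deriv_eq hp.1 hp.2
  refine (ordConnected_iff.2 fun x hx y hy _ z hz => ?_).convex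
  exact ⟨hx.1.trans_le (EReal.coe_le_coe_iff.2 hz.1),
    (EReal.coe_le_coe_iff.2 hz.2).trans_lt hy.2⟩

end EConvexDiffOn

theorem statement6
    {ι : Type*} (lf : Filter ι) [lf.NeBot]
    (μ : ι → Measure ℝ) [∀ i, IsProbabilityMeasure (μ i)]
    (c : ι → ℝ) (hc : ∀ i, 0 < c i) (hc0 : Filter.Tendsto c lf (nhds (0 : ℝ)))
    (L : ℝ → EReal) (hL : L = genLogMGF lf μ c)
    (lam : ℝ) (hlam : 0 ≤ lam) (eps : ℝ) (heps : 0 < eps)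
    (hdiff : ∀ t ∈ Set.Ioo lam (lam + eps), EDifferentiableAt L t)
    (hsup : ∀ t ∈ Set.Ioo lam (lam + eps), ∃ s ∈ Set.Ioo lam (lam + eps),
      rightDerivE L t < rightDerivE L s)
    (hrc : lam = 0 → rightLimE (rightDerivE L) 0 = ⊥ →
      Filter.Tendsto L (nhdsWithin 0 (Set.Ioi 0)) (nhds (0 : EReal)))
    :
    ∃ Φ : EReal → ℝ,
      (∀ z ∈ domD L lam eps, ∃ tz ∈ Set.Ico lam (lam + eps),
        rightLimE (rightDerivE L) tz = z) ∧
      (∀ z ∈ domD L lam eps, ∀ tz ∈ Set.Ico lam (lam + eps),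
        rightLimE (rightDerivE L) tz = z →
          ((Φ z : ℝ) : EReal) = rightLimE L tz - (tz : EReal) * z) ∧
      (∀ z ∈ domD L lam eps, Φ z ≤ 0) ∧
      StrictAntiOn Φ (domD L lam eps) ∧
      ContinuousOn Φ (domD L lam eps) ∧
      (¬ BddBelow (Φ '' domD L lam eps) ↔ leftLimE (rightDerivE L) (lam + eps) = ⊤) ∧
      (Φ (rightLimE (rightDerivE L) lam) = 0 ↔
        ((0 < lam ∧ EDifferentiableAt L lam ∧
            ∃ a : ℝ, ∀ s ∈ Set.Icc (0:ℝ) lam, L s = ((a * s : ℝ) : EReal)) ∨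
          (lam = 0 ∧ Filter.Tendsto L (nhdsWithin 0 (Set.Ioi 0)) (nhds (0 : EReal))))) ∧
      StrictConcaveOn ℝ (domDR L lam eps) (fun p : ℝ => Φ ((p : ℝ) : EReal)) ∧
      ((∀ p ∈ Set.Ioo (tildeOf L lam) (lam + eps), ∀ q ∈ Set.Ioo (tildeOf L lam) (lam + eps),
          p ≠ q → ∀ a b : ℝ, 0 < a → 0 < b → a + b = 1 →
            L (a * p + b * q) < (a : EReal) * L p + (b : EReal) * L q) →
        DifferentiableOn ℝ (fun p : ℝ => Φ ((p : ℝ) : EReal)) (domDR L lam eps)) := by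
  have h : EConvexDiffOn L lam (lam + eps) :=
    ⟨by rw [hL]; exact eConvex_genLogMGF lf μ c hc, by rw [hL]; exact genLogMGF_zero lf μ c,
      hlam, by linarith, hdiff⟩
  have hbot : rightLimE (rightDerivE L) lam = ⊥ → Tendsto L (𝓝[>] lam) (𝓝 0) := by
    intro hm
    have h0 := h.eq_zero_of_rightLimE_eq_bot hm
    rw [h0] at hm ⊢
    exact hrc h0 hm
  refine ⟨concaveConjE L lam (lam + eps), fun z hz => ?_,
    fun z hz t ht htz => h.concaveConjE_eq hsup hbot hz.2 ht htz,
    fun z hz => h.concaveConjE_nonpos hz.1 hz.2,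
    fun z hz z' hz' hlt => h.concaveConjE_lt hz.1 hlt hz'.2,
    h.continuousOn_concaveConjE hbot, h.not_bddBelow_concaveConjE_iff,
    h.concaveConjE_endpoint_eq_zero_iff hbot, h.strictConcaveOn_concaveConjE, fun hstrict p hp => ?_⟩
  · rcases hz.1.eq_or_lt with heq | hlt
    · exact ⟨lam, ⟨le_rfl, h.lt⟩, heq⟩
    · rcases eq_bot_or_coe_of_lt hz.2 with rfl | ⟨r, rfl⟩
      · exact absurd hlt not_lt_bot
      obtain ⟨t, ht, rfl⟩ := h.exists_deriv_eq hlt hz.2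
      exact ⟨t, ⟨ht.1.le, ht.2⟩, h.rightLimE_rightDerivE hsup ht⟩
  · simp only [concaveConjE_coe]
    refine (h.differentiableAt_conj hsup (fun s hs t ht hst => ?_)
      hp.1 hp.2).differentiableWithinAt
    exact hstrict s hs t ht hst 2⁻¹ 2⁻¹ (by norm_num) (by norm_num) (by norm_num)
end

section
/- Let λ ≥ 0 and ε > 0, and assume L̄ is differentiable on (λ, λ+ε). Then L̄* restricted to [L̄'_r(λ⁺), L̄'_l(λ+ε)) is [0,+∞)-valued and extends to a [0,+∞]-valued, strictly increasing, continuous map on [L̄'_r(λ⁺), L̄'_l(λ+ε)], which takes the value +∞ at L̄'_l(λ+ε) if and only if L̄'_l(λ+ε) = +∞. This map vanishes at L̄'_r(λ⁺) if and only if either λ > 0, L̄ is differentiable at λ and L̄ is linear on [0, λ], or λ = 0 and L̄ is right continuous at zero. The restriction of L̄* to the open interval (L̄'_r(λ⁺), L̄'_l(λ+ε)) is positive and strictly convex; if moreover λ̃ < λ+ε and L̄ is strictly convex on (λ̃, λ+ε), where λ̃ := sup{t > λ : L̄ is affine on (λ, t]}, then L̄* is differentiable on (L̄'_r(λ⁺),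 L̄'_l(λ+ε)). -/
open Filter MeasureTheory Set Topology

/-- Convexity of an `EReal`-valued function, phrased through real upper bounds so as to avoid
the conventions for `⊤ + ⊥`. -/
def EpiConvex (L : ℝ → EReal) : Prop :=
  ∀ ⦃s t a b p q : ℝ⦄, 0 < a → 0 < b → a + b = 1 → L s ≤ (p : EReal) → L t ≤ (q : EReal) →
    L (a * s + b * t) ≤ ((a * p + b * q : ℝ) : EReal)

lemma elog_le_iff {c : ℝ} (hc : 0 < c) (m : ENNReal) (p : ℝ) :
    elog c m ≤ (p : EReal) ↔ m ≤ ENNReal.ofReal (Real.exp (p / c)) := by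
  have h : ENNReal.log (ENNReal.ofReal (Real.exp (p / c))) = ((p / c : ℝ) : EReal) := by
    rw [ENNReal.log_ofReal_of_pos (Real.exp_pos _), Real.log_exp]
  rw [← ENNReal.log_le_log_iff, h, elog, EReal.coe_div,
    EReal.le_div_iff_mul_le (by exact_mod_cast hc) (EReal.coe_ne_top _), mul_comm]

lemma lintegral_exp_convex (μ : Measure ℝ) (c s t : ℝ) {a b : ℝ} (ha : 0 < a) (hb : 0 < b)
    (hab : a + b = 1) :
    ∫⁻ x, ENNReal.ofReal (Real.exp ((a * s + b * t) * x / c)) ∂μ ≤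
      (∫⁻ x, ENNReal.ofReal (Real.exp (s * x / c)) ∂μ) ^ a *
        (∫⁻ x, ENNReal.ofReal (Real.exp (t * x / c)) ∂μ) ^ b := by
  refine le_trans (le_of_eq ?_)
    (ENNReal.lintegral_mul_norm_pow_le (by fun_prop) (by fun_prop) ha.le hb.le hab)
  congr 1 with x
  rw [ENNReal.ofReal_rpow_of_pos (Real.exp_pos _), ENNReal.ofReal_rpow_of_pos (Real.exp_pos _),
    ← ENNReal.ofReal_mul (by positivity), ← Real.exp_mul, ← Real.exp_mul, ← Real.exp_add]
  congr 2
  ring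

lemma elog_lintegral_exp_convex (μ : Measure ℝ) {c s t a b p q : ℝ} (hc : 0 < c) (ha : 0 < a)
    (hb : 0 < b) (hab : a + b = 1)
    (hs : elog c (∫⁻ x, ENNReal.ofReal (Real.exp (s * x / c)) ∂μ) ≤ (p : EReal))
    (ht : elog c (∫⁻ x, ENNReal.ofReal (Real.exp (t * x / c)) ∂μ) ≤ (q : EReal)) :
    elog c (∫⁻ x, ENNReal.ofReal (Real.exp ((a * s + b * t) * x / c)) ∂μ) ≤
      ((a * p + b * q : ℝ) : EReal) := by
  rw [elog_le_iff hc] at *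
  refine (lintegral_exp_convex μ c s t ha hb hab).trans ?_
  refine (mul_le_mul' (ENNReal.rpow_le_rpow hs ha.le) (ENNReal.rpow_le_rpow ht hb.le)).trans ?_
  rw [ENNReal.ofReal_rpow_of_pos (Real.exp_pos _), ENNReal.ofReal_rpow_of_pos (Real.exp_pos _),
    ← ENNReal.ofReal_mul (by positivity), ← Real.exp_mul, ← Real.exp_mul, ← Real.exp_add]
  refine le_of_eq ?_
  congr 2
  ring

lemma le_coe_of_forall_pos_le_add {x : EReal} {r : ℝ}
    (h : ∀ δ : ℝ, 0 < δ → x ≤ ((r + δ : ℝ) : EReal)) : x ≤ (r : EReal) := by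
  refine EReal.le_of_forall_lt_iff_le.mp fun z hz => ?_
  have hrz : r < z := by exact_mod_cast hz
  simpa only [add_sub_cancel] using h (z - r) (sub_pos.mpr hrz)

lemma genLogMGF_epiConvex {ι : Type*} (lf : Filter ι) (μ : ι → Measure ℝ) (c : ι → ℝ)
    (hc : ∀ i, 0 < c i) : EpiConvex (genLogMGF lf μ c) := by
  intro s t a b p q ha hb hab hs ht
  refine le_coe_of_forall_pos_le_add fun δ hδ => ?_
  have hs' : genLogMGF lf μ c s < ((p + δ : ℝ) : EReal) :=
    hs.trans_lt (by exact_mod_cast lt_add_of_pos_right p hδ)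
  have ht' : genLogMGF lf μ c t < ((q + δ : ℝ) : EReal) :=
    ht.trans_lt (by exact_mod_cast lt_add_of_pos_right q hδ)
  have hpq : a * p + b * q + δ = a * (p + δ) + b * (q + δ) := by linear_combination (-δ) * hab
  rw [hpq]
  refine limsup_le_of_le ?_ ?_
  · isBoundedDefault
  filter_upwards [eventually_lt_of_limsup_lt hs', eventually_lt_of_limsup_lt ht'] with i hi hi'
  exact elog_lintegral_exp_convex (μ i) (hc i) ha hb hab hi.le hi'.le

/-- At a point of differentiability, a convex function lies above its tangent line. -/
lemma EpiConvex.tangent_le {L : ℝ → EReal} (hL : EpiConvex L) {t r d : ℝ} (hr : L t = (r : EReal))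
    (hd : Tendsto (fun s => (L s - L t) * (((s - t)⁻¹ : ℝ) : EReal)) (𝓝[≠] t) (𝓝 (d : EReal)))
    (s : ℝ) : ((r + d * (s - t) : ℝ) : EReal) ≤ L s := by
  rcases eq_or_ne s t with rfl | hst
  · simp [hr]
  by_contra! hlt
  obtain ⟨p, hsp, hp⟩ := EReal.lt_iff_exists_real_btwn.mp hlt
  replace hp : p < r + d * (s - t) := by exact_mod_cast hp
  have hne : s - t ≠ 0 := sub_ne_zero.mpr hst
  have key : ∀ a ∈ Ioo (0 : ℝ) 1, L (t + a * (s - t)) ≤ ((r + a * (p - r) : ℝ) : EReal) := by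
    intro a ha
    convert hL (sub_pos.mpr ha.2) ha.1 (by ring) hr.le hsp.le using 2 <;> ring_nf
  have hlim : Tendsto (fun a : ℝ => t + a * (s - t)) (𝓝[>] 0) (𝓝[≠] t) := by
    refine tendsto_nhdsWithin_iff.mpr ⟨?_, ?_⟩
    · have : Continuous fun a : ℝ => t + a * (s - t) := by fun_prop
      simpa using (this.tendsto 0).mono_left nhdsWithin_le_nhds
    · filter_upwards [self_mem_nhdsWithin] with a ha
      simpa [hne] using (ne_of_gt ha : a ≠ 0)
  have hd' := hd.comp hlim
  have hmem : ∀ᶠ a in 𝓝[>] (0 : ℝ), a ∈ Ioo (0 : ℝ) 1 := Ioo_mem_nhdsGT one_pos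
  have hdiv : ∀ a ∈ Ioo (0 : ℝ) 1,
      (r + a * (p - r) - r) * (t + a * (s - t) - t)⁻¹ = (p - r) / (s - t) := by
    intro a ha
    have := ha.1.ne'
    field_simp
    ring
  rcases lt_or_gt_of_ne hst with h | h
  · have : (((p - r) / (s - t) : ℝ) : EReal) ≤ (d : EReal) := by
      refine ge_of_tendsto hd' ?_
      filter_upwards [hmem] with a ha
      rw [← hdiv a ha, EReal.coe_mul, EReal.coe_sub]
      simp only [Function.comp, hr]
      refine EReal.mul_le_mul_of_nonpos_right (EReal.sub_le_sub (key a ha) le_rfl) ?_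
      rw [← EReal.coe_zero, EReal.coe_le_coe_iff, inv_nonpos]
      nlinarith [ha.1]
    replace this : (p - r) / (s - t) ≤ d := by exact_mod_cast this
    rw [div_le_iff_of_neg (by linarith)] at this
    linarith
  · have : (d : EReal) ≤ (((p - r) / (s - t) : ℝ) : EReal) := by
      refine le_of_tendsto hd' ?_
      filter_upwards [hmem] with a ha
      rw [← hdiv a ha, EReal.coe_mul, EReal.coe_sub]
      simp only [Function.comp, hr]
      refine mul_le_mul_of_nonneg_right (EReal.sub_le_sub (key a ha) le_rfl) ?_
      rw [← EReal.coe_zero, EReal.coe_le_coe_iff, inv_nonneg]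
      nlinarith [ha.1]
    replace this : d ≤ (p - r) / (s - t) := by exact_mod_cast this
    rw [le_div_iff₀ (by linarith)] at this
    linarith

/-- `L` vanishes at `0` and agrees on `(a, b) ⊆ [0, ∞)` with a real function `f` with
derivative `f'`, all of whose tangent lines on `(a, b)` are global minorants of `L`. -/
structure SmoothConvexOn (L : ℝ → EReal) (f f' : ℝ → ℝ) (a b : ℝ) : Prop where
  zero : L 0 = 0
  nonneg : 0 ≤ a
  lt : a < b
  coe_eq : ∀ t ∈ Ioo a b, L t = (f t : EReal)
  deriv : ∀ t ∈ Ioo a b, HasDerivAt f (f' t) t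
  tangent : ∀ t ∈ Ioo a b, ∀ s, ((f t + f' t * (s - t) : ℝ) : EReal) ≤ L s

lemma EpiConvex.exists_smoothConvexOn {L : ℝ → EReal} (hL : EpiConvex L) (h0 : L 0 = 0) {a b : ℝ}
    (ha : 0 ≤ a) (hab : a < b) (hdiff : ∀ t ∈ Ioo a b, EDifferentiableAt L t) :
    ∃ f f' : ℝ → ℝ, SmoothConvexOn L f f' a b := by
  choose! f hf using fun t ht => (hdiff t ht).1
  choose! f' hf' using fun t ht => (hdiff t ht).2
  refine ⟨f, f', h0, ha, hab, hf, fun t ht => ?_, fun t ht => hL.tangent_le (hf t ht) (hf' t ht)⟩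
  rw [hasDerivAt_iff_tendsto_slope, ← EReal.tendsto_coe]
  refine (hf' t ht).congr' ?_
  filter_upwards [nhdsWithin_le_nhds (Ioo_mem_nhds ht.1 ht.2)] with s hs
  rw [hf t ht, hf s hs, slope_def_field, div_eq_mul_inv]
  norm_cast

namespace SmoothConvexOn

variable {L : ℝ → EReal} {f f' : ℝ → ℝ} {a b : ℝ}

/-- The infimum of the slopes of `L` on `(a, b)`. -/
noncomputable def slopeInf (f' : ℝ → ℝ) (a b : ℝ) : EReal := sInf ((fun t => (f' t : EReal)) '' Ioo a b)

/-- The supremum of the slopes of `L` on `(a, b)`. -/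
noncomputable def slopeSup (f' : ℝ → ℝ) (a b : ℝ) : EReal := sSup ((fun t => (f' t : EReal)) '' Ioo a b)

lemma slopeInf_le {t : ℝ} (ht : t ∈ Ioo a b) : slopeInf f' a b ≤ (f' t : EReal) :=
  sInf_le (mem_image_of_mem _ ht)

lemma le_slopeSup {t : ℝ} (ht : t ∈ Ioo a b) : (f' t : EReal) ≤ slopeSup f' a b :=
  le_sSup (mem_image_of_mem _ ht)

lemma exists_lt_of_slopeInf_lt {x : EReal} (h : slopeInf f' a b < x) :
    ∃ t ∈ Ioo a b, (f' t : EReal) < x := by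
  simpa [slopeInf, sInf_lt_iff] using h

lemma exists_gt_of_lt_slopeSup {x : EReal} (h : x < slopeSup f' a b) :
    ∃ t ∈ Ioo a b, x < (f' t : EReal) := by
  simpa [slopeSup, lt_sSup_iff] using h

lemma tangent_real (h : SmoothConvexOn L f f' a b) {s t : ℝ} (ht : t ∈ Ioo a b)
    (hs : s ∈ Ioo a b) : f t + f' t * (s - t) ≤ f s := by
  have := h.tangent t ht s
  rw [h.coe_eq s hs] at this
  exact_mod_cast this

lemma ne_bot (h : SmoothConvexOn L f f' a b) (s : ℝ) : L s ≠ ⊥ := by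
  obtain ⟨t, ht⟩ := nonempty_Ioo.mpr h.lt
  exact ((EReal.bot_lt_coe _).trans_le (h.tangent t ht s)).ne'

lemma monotoneOn (h : SmoothConvexOn L f f' a b) : MonotoneOn f' (Ioo a b) := by
  intro s hs t ht hst
  rcases hst.eq_or_lt with rfl | hst
  · exact le_rfl
  nlinarith [h.tangent_real hs ht, h.tangent_real ht hs]

lemma pos (h : SmoothConvexOn L f f' a b) {t : ℝ} (ht : t ∈ Ioo a b) : 0 < t :=
  h.nonneg.trans_lt ht.1

lemma rightDerivE_eq (h : SmoothConvexOn L f f' a b) {t : ℝ} (ht : t ∈ Ioo a b) :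
    rightDerivE L t = (f' t : EReal) := by
  obtain ⟨u, htu, hub⟩ := exists_between ht.2
  have hL : ¬ ∀ s : ℝ, t < s → L s = ⊤ := fun hs => by
    have := hs u htu
    rw [h.coe_eq u ⟨ht.1.trans htu, hub⟩] at this
    exact EReal.coe_ne_top _ this
  have hL' : ¬ ∃ s : ℝ, t < s ∧ L s = ⊥ := fun ⟨s, _, hs⟩ => h.ne_bot s hs
  rw [rightDerivE, if_neg hL, if_neg hL']
  refine le_antisymm ?_ (le_iInf₂ fun s hs => ?_)
  · have hlim := EReal.tendsto_coe.mpr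
      ((h.deriv t ht).tendsto_slope.mono_left (nhdsGT_le_nhdsNE t))
    refine ge_of_tendsto hlim ?_
    filter_upwards [Ioo_mem_nhdsGT ht.2] with s hs
    refine (iInf₂_le s hs.1).trans (le_of_eq ?_)
    rw [h.coe_eq t ht, h.coe_eq s ⟨ht.1.trans hs.1, hs.2⟩, slope_def_field, div_eq_mul_inv]
    norm_cast
  · have hst : 0 < s - t := sub_pos.mpr hs
    have hle : ((f t + f' t * (s - t) : ℝ) : EReal) - (f t : EReal) ≤ L s - L t := by
      rw [h.coe_eq t ht]
      exact EReal.sub_le_sub (h.tangent t ht s) le_rfl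
    refine le_trans (le_of_eq ?_) (mul_le_mul_of_nonneg_right hle
      (by exact_mod_cast (inv_pos.mpr hst).le))
    rw [← EReal.coe_sub, ← EReal.coe_mul]
    congr 1
    field_simp
    ring

lemma tendsto_slope_slopeInf (h : SmoothConvexOn L f f' a b) :
    Tendsto (fun t => (f' t : EReal)) (𝓝[>] a) (𝓝 (slopeInf f' a b)) :=
  MonotoneOn.tendsto_nhdsWithin_Ioo_right (nonempty_Ioo.mpr h.lt)
    (fun _ hs _ ht hst => EReal.coe_le_coe_iff.mpr (h.monotoneOn hs ht hst)) (OrderBot.bddBelow _)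

lemma rightLimE_eq (h : SmoothConvexOn L f f' a b) :
    rightLimE (rightDerivE L) a = slopeInf f' a b := by
  refine Tendsto.limsup_eq (h.tendsto_slope_slopeInf.congr' ?_)
  filter_upwards [Ioo_mem_nhdsGT h.lt] with t ht using (h.rightDerivE_eq ht).symm

lemma leftLimE_eq (h : SmoothConvexOn L f f' a b) :
    leftLimE (rightDerivE L) b = slopeSup f' a b := by
  have hmono : MonotoneOn (fun t => (f' t : EReal)) (Ioo a b) :=
    fun s hs t ht hst => EReal.coe_le_coe_iff.mpr (h.monotoneOn hs ht hst)
  refine Tendsto.limsup_eq ((MonotoneOn.tendsto_nhdsWithin_Ioo_left (nonempty_Ioo.mpr h.lt) hmono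
    (OrderTop.bddAbove _)).congr' ?_)
  filter_upwards [Ioo_mem_nhdsLT h.lt] with t ht using (h.rightDerivE_eq ht).symm

lemma slopeInf_lt_top (h : SmoothConvexOn L f f' a b) : slopeInf f' a b < ⊤ := by
  obtain ⟨t, ht⟩ := nonempty_Ioo.mpr h.lt
  exact (slopeInf_le ht).trans_lt (EReal.coe_lt_top _)

lemma slopeInf_le_slopeSup (h : SmoothConvexOn L f f' a b) :
    slopeInf f' a b ≤ slopeSup f' a b := by
  obtain ⟨t, ht⟩ := nonempty_Ioo.mpr h.lt
  exact (slopeInf_le ht).trans (le_slopeSup ht)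

lemma exists_slope_eq (h : SmoothConvexOn L f f' a b) {z : ℝ} (hz : slopeInf f' a b < z)
    (hz' : (z : EReal) < slopeSup f' a b) : ∃ t ∈ Ioo a b, f' t = z := by
  obtain ⟨s, hs, hsz⟩ := exists_lt_of_slopeInf_lt hz
  obtain ⟨t, ht, hzt⟩ := exists_gt_of_lt_slopeSup hz'
  exact (ordConnected_Ioo.image_hasDerivWithinAt fun x hx => (h.deriv x hx).hasDerivWithinAt).out
    (mem_image_of_mem _ hs) (mem_image_of_mem _ ht)
    ⟨(EReal.coe_lt_coe_iff.mp hsz).le, (EReal.coe_lt_coe_iff.mp hzt).le⟩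

lemma le_legendre (h : SmoothConvexOn L f f' a b) (z : ℝ) {t : ℝ} (ht : t ∈ Ioo a b) :
    ((z * t - f t : ℝ) : EReal) ≤ LegendreEE L z := by
  refine le_iSup_of_le t (le_of_eq ?_)
  rw [h.coe_eq t ht, mul_comm z t]
  norm_cast

lemma legendre_nonneg (h : SmoothConvexOn L f f' a b) (z : EReal) : 0 ≤ LegendreEE L z :=
  le_iSup_of_le 0 (by simp [h.zero])

/-- An affine minorant of `L` with slope `z` bounds the Legendre transform at `z`. -/
lemma _root_.legendre_le_of_forall_le {L : ℝ → EReal} {z q : ℝ}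
    (hq : ∀ s : ℝ, ((z * s - q : ℝ) : EReal) ≤ L s) : LegendreEE L z ≤ (q : EReal) := by
  refine iSup_le fun s => ?_
  have hs := hq s
  induction hLs : L s with
  | bot =>
    rw [hLs, le_bot_iff] at hs
    exact absurd hs (EReal.coe_ne_bot _)
  | top => simp [EReal.sub_top]
  | coe r =>
    rw [hLs] at hs
    have : z * s - q ≤ r := by exact_mod_cast hs
    have : s * z - r ≤ q := by linarith
    exact_mod_cast this

lemma legendre_slope (h : SmoothConvexOn L f f' a b) {t : ℝ} (ht : t ∈ Ioo a b) :
    LegendreEE L (f' t) = ((f' t * t - f t : ℝ) : EReal) := by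
  refine le_antisymm (legendre_le_of_forall_le fun s => ?_) (h.le_legendre _ ht)
  convert h.tangent t ht s using 2
  ring

lemma slope_mul_sub_nonneg (h : SmoothConvexOn L f f' a b) {t : ℝ} (ht : t ∈ Ioo a b) :
    0 ≤ f' t * t - f t := by
  have := h.legendre_nonneg (f' t)
  rw [h.legendre_slope ht] at this
  exact_mod_cast this

/-- The tangent point for a slope in the open range of slopes. -/
lemma exists_tangent_point (h : SmoothConvexOn L f f' a b) {z : ℝ} (hz : slopeInf f' a b < z)
    (hz' : (z : EReal) < slopeSup f' a b) :
    ∃ t ∈ Ioo a b, f' t = z ∧ LegendreEE L z = ((z * t - f t : ℝ) : EReal) := by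
  obtain ⟨t, ht, rfl⟩ := h.exists_slope_eq hz hz'
  exact ⟨t, ht, rfl, h.legendre_slope ht⟩

/-- The real numbers strictly between the extreme slopes of `L` on `(a, b)`. -/
def slopeRange (f' : ℝ → ℝ) (a b : ℝ) : Set ℝ :=
  {z | slopeInf f' a b < (z : EReal) ∧ (z : EReal) < slopeSup f' a b}

lemma convex_slopeRange : Convex ℝ (slopeRange f' a b) := by
  refine OrdConnected.convex ⟨fun x hx y hy z hz => ⟨?_, ?_⟩⟩
  · exact hx.1.trans_le (EReal.coe_le_coe_iff.mpr hz.1)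
  · exact (EReal.coe_le_coe_iff.mpr hz.2).trans_lt hy.2

lemma isOpen_slopeRange : IsOpen (slopeRange f' a b) :=
  isOpen_Ioo.preimage continuous_coe_real_ereal

lemma coe_toReal_legendre (h : SmoothConvexOn L f f' a b) {z : ℝ} (hz : z ∈ slopeRange f' a b) :
    ((LegendreEE L z).toReal : EReal) = LegendreEE L z := by
  obtain ⟨t, -, -, hK⟩ := h.exists_tangent_point hz.1 hz.2
  rw [hK, EReal.toReal_coe]

lemma le_toReal_legendre (h : SmoothConvexOn L f f' a b) {z : ℝ} (hz : z ∈ slopeRange f' a b)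
    {t : ℝ} (ht : t ∈ Ioo a b) : z * t - f t ≤ (LegendreEE L z).toReal := by
  have := h.le_legendre z ht
  rw [← h.coe_toReal_legendre hz] at this
  exact_mod_cast this

lemma lt_toReal_legendre (h : SmoothConvexOn L f f' a b) {z : ℝ} (hz : z ∈ slopeRange f' a b)
    {t : ℝ} (ht : t ∈ Ioo a b) (hne : f' t ≠ z) : z * t - f t < (LegendreEE L z).toReal := by
  refine (h.le_toReal_legendre hz ht).lt_of_ne fun heq => hne ?_
  obtain ⟨u, hu, rfl, hK⟩ := h.exists_tangent_point hz.1 hz.2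
  rw [hK, EReal.toReal_coe] at heq
  have hmin : IsLocalMin (fun s => f s - f' u * s) t := by
    filter_upwards [Ioo_mem_nhds ht.1 ht.2] with s hs
    linarith [h.tangent_real hu hs]
  have := hmin.hasDerivAt_eq_zero ((h.deriv t ht).sub ((hasDerivAt_id t).const_mul (f' u)))
  linarith

lemma strictConvexOn_legendre (h : SmoothConvexOn L f f' a b) :
    StrictConvexOn ℝ (slopeRange f' a b) fun z : ℝ => (LegendreEE L z).toReal := by
  refine ⟨convex_slopeRange, fun x hx y hy hxy p q hp hq hpq => ?_⟩
  have hz : p • x + q • y ∈ slopeRange f' a b := convex_slopeRange hx hy hp.le hq.le hpq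
  obtain ⟨t, ht, htz, hK⟩ := h.exists_tangent_point hz.1 hz.2
  simp only [smul_eq_mul] at *
  have hqe : q = 1 - p := by linarith
  subst hqe
  have hne : f' t ≠ x := fun hx' => hxy (mul_left_cancel₀ hq.ne' (by linarith))
  have h1 := h.lt_toReal_legendre hx ht hne
  have h2 := h.le_toReal_legendre hy ht
  rw [hK, EReal.toReal_coe]
  nlinarith [mul_lt_mul_of_pos_left h1 hp, mul_le_mul_of_nonneg_left h2 hq.le]

lemma exists_legendre_sub_bounds (h : SmoothConvexOn L f f' a b) {z w : ℝ}
    (hz : z ∈ slopeRange f' a b) (hw : w ∈ slopeRange f' a b) :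
    ∃ s ∈ Ioo a b, ∃ t ∈ Ioo a b, f' s = z ∧ f' t = w ∧
      (w - z) * s ≤ (LegendreEE L w).toReal - (LegendreEE L z).toReal ∧
      (LegendreEE L w).toReal - (LegendreEE L z).toReal ≤ (w - z) * t := by
  obtain ⟨s, hs, hsz, hKz⟩ := h.exists_tangent_point hz.1 hz.2
  obtain ⟨t, ht, htw, hKw⟩ := h.exists_tangent_point hw.1 hw.2
  refine ⟨s, hs, t, ht, hsz, htw, ?_, ?_⟩
  · have := h.le_toReal_legendre hw hs
    rw [hKz, EReal.toReal_coe]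
    linarith
  · have := h.le_toReal_legendre hz ht
    rw [hKw, EReal.toReal_coe]
    linarith

/-- If `f'` is strictly increasing from some point of `(a, b)` with minimal slope on, the Legendre
transform is differentiable in the open range of slopes. -/
lemma differentiableOn_legendre (h : SmoothConvexOn L f f' a b)
    (hstrict : ∀ t ∈ Ioo a b, slopeInf f' a b < (f' t : EReal) → ∃ u < t, ∀ p ∈ Ioo u b,
      ∀ q ∈ Ioo u b, p < q → f' p < f' q) :
    DifferentiableOn ℝ (fun z : ℝ => (LegendreEE L z).toReal) (slopeRange f' a b) := by
  intro z hz
  obtain ⟨t, ht, htz⟩ := h.exists_slope_eq hz.1 hz.2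
  obtain ⟨u, hut, hu⟩ := hstrict t ht (htz ▸ hz.1)
  suffices HasDerivAt (fun z : ℝ => (LegendreEE L z).toReal) t z from
    this.differentiableAt.differentiableWithinAt
  rw [hasDerivAt_iff_isLittleO, Asymptotics.isLittleO_iff]
  intro δ hδ
  obtain ⟨p, hp, hpt⟩ := exists_between (max_lt (max_lt hut ht.1) (sub_lt_self t hδ))
  obtain ⟨q, htq, hq⟩ := exists_between (lt_min ht.2 (lt_add_of_pos_right t hδ))
  simp only [max_lt_iff, lt_min_iff] at hp hq
  have hpI : p ∈ Ioo a b := ⟨hp.1.2, hpt.trans ht.2⟩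
  have hqI : q ∈ Ioo a b := ⟨ht.1.trans htq, hq.1⟩
  have hpz : f' p < z := htz ▸ hu p ⟨hp.1.1, hpI.2⟩ t ⟨hut, ht.2⟩ hpt
  have hzq : z < f' q := htz ▸ hu t ⟨hut, ht.2⟩ q ⟨hut.trans htq, hq.1⟩ htq
  filter_upwards [Ioo_mem_nhds hpz hzq, isOpen_slopeRange.mem_nhds hz] with w hw hwS
  obtain ⟨s, hs, r, hr, hsz, hrw, h1, h2⟩ := h.exists_legendre_sub_bounds hz hwS
  have hst : s = t := by
    have hps : p < s := by
      by_contra! hle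
      linarith [h.monotoneOn hs hpI hle]
    rcases lt_trichotomy s t with hlt | heq | hgt
    · linarith [hu s ⟨hp.1.1.trans hps, hs.2⟩ t ⟨hut, ht.2⟩ hlt]
    · exact heq
    · linarith [hu t ⟨hut, ht.2⟩ s ⟨hut.trans hgt, hs.2⟩ hgt]
  have hpr : p < r := by
    by_contra! hle
    linarith [h.monotoneOn hr hpI hle, hw.1]
  have hrq : r < q := by
    by_contra! hle
    linarith [h.monotoneOn hqI hr hle, hw.2]
  have hrt : |r - t| ≤ δ := abs_le.mpr ⟨by linarith, by linarith⟩
  subst hst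
  rw [smul_eq_mul, Real.norm_eq_abs, Real.norm_eq_abs, abs_of_nonneg (by linarith)]
  calc _ ≤ (r - s) * (w - z) := by linarith
    _ ≤ |r - s| * |w - z| := by rw [← abs_mul]; exact le_abs_self _
    _ ≤ δ * |w - z| := by gcongr

lemma exists_coe_of_mem_Ioo {x : EReal} (hx : x ∈ Ioo (slopeInf f' a b) (slopeSup f' a b)) :
    ∃ z ∈ slopeRange f' a b, (z : EReal) = x := by
  have hx' := EReal.coe_toReal (hx.2.trans_le le_top).ne (bot_le.trans_lt hx.1).ne'
  exact ⟨x.toReal, by rwa [slopeRange, mem_ofPred_eq, hx'], hx'⟩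

lemma strictMonoOn_legendre (h : SmoothConvexOn L f f' a b) :
    StrictMonoOn (LegendreEE L) (Ioo (slopeInf f' a b) (slopeSup f' a b)) := by
  intro x hx y hy hxy
  obtain ⟨z, hz, rfl⟩ := exists_coe_of_mem_Ioo hx
  obtain ⟨w, hw, rfl⟩ := exists_coe_of_mem_Ioo hy
  obtain ⟨s, hs, -, -, -, -, hle, -⟩ := h.exists_legendre_sub_bounds hz hw
  have hzw : 0 < w - z := sub_pos.mpr (EReal.coe_lt_coe_iff.mp hxy)
  rw [← h.coe_toReal_legendre hz, ← h.coe_toReal_legendre hw, EReal.coe_lt_coe_iff]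
  linarith [mul_pos hzw (h.pos hs)]

lemma continuousOn_legendre (h : SmoothConvexOn L f f' a b) :
    ContinuousOn (LegendreEE L) (Ioo (slopeInf f' a b) (slopeSup f' a b)) := by
  intro x hx
  obtain ⟨z, hz, rfl⟩ := exists_coe_of_mem_Ioo hx
  refine ContinuousAt.continuousWithinAt ?_
  rw [← EReal.isOpenEmbedding_coe.continuousAt_iff]
  have hS : slopeRange f' a b ∈ 𝓝 z := isOpen_slopeRange.mem_nhds hz
  have hk := (h.strictConvexOn_legendre.convexOn.continuousOn isOpen_slopeRange).continuousAt hS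
  refine ((continuous_coe_real_ereal.continuousAt).comp hk).congr ?_
  filter_upwards [hS] with w hw using h.coe_toReal_legendre hw

/-- The continuous extension of the Legendre transform to the closed range of slopes. -/
noncomputable def legendreExtension (L : ℝ → EReal) (f' : ℝ → ℝ) (a b : ℝ) : EReal → EReal :=
  extendFrom (Ioo (slopeInf f' a b) (slopeSup f' a b)) (LegendreEE L)

lemma tendsto_legendre_slopeInf (h : SmoothConvexOn L f f' a b)
    (hlt : slopeInf f' a b < slopeSup f' a b) :
    Tendsto (LegendreEE L) (𝓝[>] slopeInf f' a b)
      (𝓝 (sInf (LegendreEE L '' Ioo (slopeInf f' a b) (slopeSup f' a b)))) :=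
  MonotoneOn.tendsto_nhdsWithin_Ioo_right (nonempty_Ioo.mpr hlt) h.strictMonoOn_legendre.monotoneOn
    (OrderBot.bddBelow _)

lemma tendsto_legendre_slopeSup (h : SmoothConvexOn L f f' a b)
    (hlt : slopeInf f' a b < slopeSup f' a b) :
    Tendsto (LegendreEE L) (𝓝[<] slopeSup f' a b)
      (𝓝 (sSup (LegendreEE L '' Ioo (slopeInf f' a b) (slopeSup f' a b)))) :=
  MonotoneOn.tendsto_nhdsWithin_Ioo_left (nonempty_Ioo.mpr hlt) h.strictMonoOn_legendre.monotoneOn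
    (OrderTop.bddAbove _)

lemma continuousOn_legendreExtension (h : SmoothConvexOn L f f' a b)
    (hlt : slopeInf f' a b < slopeSup f' a b) :
    ContinuousOn (legendreExtension L f' a b) (Icc (slopeInf f' a b) (slopeSup f' a b)) :=
  continuousOn_Icc_extendFrom_Ioo h.continuousOn_legendre (h.tendsto_legendre_slopeInf hlt)
    (h.tendsto_legendre_slopeSup hlt)

lemma legendreExtension_of_mem_Ioo (h : SmoothConvexOn L f f' a b) {x : EReal}
    (hx : x ∈ Ioo (slopeInf f' a b) (slopeSup f' a b)) :
    legendreExtension L f' a b x = LegendreEE L x :=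
  extendFrom_extends h.continuousOn_legendre x hx

lemma legendreExtension_slopeInf (h : SmoothConvexOn L f f' a b)
    (hlt : slopeInf f' a b < slopeSup f' a b) :
    legendreExtension L f' a b (slopeInf f' a b) =
      sInf (LegendreEE L '' Ioo (slopeInf f' a b) (slopeSup f' a b)) :=
  eq_lim_at_left_extendFrom_Ioo hlt (h.tendsto_legendre_slopeInf hlt)

lemma legendreExtension_slopeSup (h : SmoothConvexOn L f f' a b)
    (hlt : slopeInf f' a b < slopeSup f' a b) :
    legendreExtension L f' a b (slopeSup f' a b) =
      sSup (LegendreEE L '' Ioo (slopeInf f' a b) (slopeSup f' a b)) :=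
  eq_lim_at_right_extendFrom_Ioo hlt (h.tendsto_legendre_slopeSup hlt)

lemma legendreExtension_slopeInf_le (h : SmoothConvexOn L f f' a b) {x : EReal}
    (hx : x ∈ Ioo (slopeInf f' a b) (slopeSup f' a b)) :
    legendreExtension L f' a b (slopeInf f' a b) ≤ LegendreEE L x := by
  rw [h.legendreExtension_slopeInf (hx.1.trans hx.2)]
  exact sInf_le (mem_image_of_mem _ hx)

lemma le_legendreExtension_slopeSup (h : SmoothConvexOn L f f' a b) {x : EReal}
    (hx : x ∈ Ioo (slopeInf f' a b) (slopeSup f' a b)) :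
    LegendreEE L x ≤ legendreExtension L f' a b (slopeSup f' a b) := by
  rw [h.legendreExtension_slopeSup (hx.1.trans hx.2)]
  exact le_sSup (mem_image_of_mem _ hx)

lemma strictMonoOn_legendreExtension (h : SmoothConvexOn L f f' a b) :
    StrictMonoOn (legendreExtension L f' a b) (Icc (slopeInf f' a b) (slopeSup f' a b)) := by
  intro x hx y hy hxy
  obtain ⟨u, hxu, huy⟩ := exists_between hxy
  obtain ⟨v, huv, hvy⟩ := exists_between huy
  have hu : u ∈ Ioo (slopeInf f' a b) (slopeSup f' a b) := ⟨hx.1.trans_lt hxu, huy.trans_le hy.2⟩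
  have hv : v ∈ Ioo (slopeInf f' a b) (slopeSup f' a b) := ⟨hu.1.trans huv, hvy.trans_le hy.2⟩
  have h1 : legendreExtension L f' a b x ≤ LegendreEE L u := by
    rcases hx.1.eq_or_lt with rfl | hx'
    · exact h.legendreExtension_slopeInf_le hu
    · have hxI := And.intro hx' (hxu.trans hu.2)
      rw [h.legendreExtension_of_mem_Ioo hxI]
      exact (h.strictMonoOn_legendre hxI hu hxu).le
  have h2 : LegendreEE L v ≤ legendreExtension L f' a b y := by
    rcases hy.2.eq_or_lt with rfl | hy'
    · exact h.le_legendreExtension_slopeSup hv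
    · have hyI := And.intro (hv.1.trans hvy) hy'
      rw [h.legendreExtension_of_mem_Ioo hyI]
      exact (h.strictMonoOn_legendre hv hyI hvy).le
  exact h1.trans_lt ((h.strictMonoOn_legendre hu hv huv).trans_le h2)

lemma legendreExtension_nonneg (h : SmoothConvexOn L f f' a b)
    (hlt : slopeInf f' a b < slopeSup f' a b) {x : EReal}
    (hx : x ∈ Icc (slopeInf f' a b) (slopeSup f' a b)) : 0 ≤ legendreExtension L f' a b x := by
  refine le_trans ?_
    (h.strictMonoOn_legendreExtension.monotoneOn (left_mem_Icc.mpr hlt.le) hx hx.1)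
  rw [h.legendreExtension_slopeInf hlt]
  refine le_sInf ?_
  rintro _ ⟨y, -, rfl⟩
  exact h.legendre_nonneg y

/-- When the minimal slope is finite, the extension agrees there with the Legendre transform. -/
lemma legendreExtension_slopeInf_eq_legendre (h : SmoothConvexOn L f f' a b)
    (hlt : slopeInf f' a b < slopeSup f' a b) {z : ℝ} (hz : slopeInf f' a b = z) :
    legendreExtension L f' a b (slopeInf f' a b) = LegendreEE L z := by
  have hev : ∀ᶠ v in 𝓝[>] z, v ∈ slopeRange f' a b := by
    have hR : ∀ᶠ v : ℝ in 𝓝 z, (v : EReal) < slopeSup f' a b :=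
      (continuous_coe_real_ereal.tendsto z).eventually_lt_const (hz ▸ hlt)
    filter_upwards [nhdsWithin_le_nhds hR, self_mem_nhdsWithin] with v hv hzv
    exact ⟨hz ▸ EReal.coe_lt_coe_iff.mpr hzv, hv⟩
  have hle : ∀ w ∈ slopeRange f' a b, LegendreEE L z ≤ ((LegendreEE L w).toReal : EReal) := by
    intro w hw
    refine legendre_le_of_forall_le fun s => ?_
    have hlim : Tendsto (fun v : ℝ => ((v * s - (LegendreEE L w).toReal : ℝ) : EReal)) (𝓝[>] z)
        (𝓝 ((z * s - (LegendreEE L w).toReal : ℝ) : EReal)) := by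
      have : Continuous fun v : ℝ => ((v * s - (LegendreEE L w).toReal : ℝ) : EReal) :=
        continuous_coe_real_ereal.comp (by fun_prop)
      exact (this.tendsto z).mono_left nhdsWithin_le_nhds
    have hzw : z < w := EReal.coe_lt_coe_iff.mp (hz ▸ hw.1)
    refine le_of_tendsto hlim ?_
    filter_upwards [hev, Ioo_mem_nhdsGT hzw] with v hv hvw
    obtain ⟨t, ht, hvt, hK⟩ := h.exists_tangent_point hv.1 hv.2
    refine le_trans (EReal.coe_le_coe_iff.mpr ?_) (h.tangent t ht s)
    have := h.strictMonoOn_legendre.monotoneOn hv hw (EReal.coe_le_coe_iff.mpr hvw.2.le)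
    rw [hK, ← h.coe_toReal_legendre hw, EReal.coe_le_coe_iff] at this
    rw [hvt]
    linarith
  refine le_antisymm ?_ ?_
  · obtain ⟨w₀, hw₀⟩ := hev.exists
    have hfin : ((LegendreEE L z).toReal : EReal) = LegendreEE L z :=
      EReal.coe_toReal ((hle w₀ hw₀).trans_lt (EReal.coe_lt_top _)).ne
        (EReal.bot_lt_zero.trans_le (h.legendre_nonneg z)).ne'
    have hlim : Tendsto (fun w : ℝ => (((LegendreEE L z).toReal + (w - z) * b : ℝ) : EReal))
        (𝓝[>] z) (𝓝 (LegendreEE L z)) := by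
      have : Continuous fun w : ℝ => (((LegendreEE L z).toReal + (w - z) * b : ℝ) : EReal) :=
        continuous_coe_real_ereal.comp (by fun_prop)
      have := (this.tendsto z).mono_left (nhdsWithin_le_nhds (s := Ioi z))
      rwa [sub_self, zero_mul, add_zero, hfin] at this
    refine ge_of_tendsto hlim ?_
    filter_upwards [hev, self_mem_nhdsWithin] with w hw hzw
    refine (h.legendreExtension_slopeInf_le hw).trans ?_
    obtain ⟨t, ht, -, hK⟩ := h.exists_tangent_point hw.1 hw.2
    have := h.le_legendre z ht
    rw [← hfin, EReal.coe_le_coe_iff] at this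
    rw [hK, EReal.coe_le_coe_iff]
    have : (w - z) * t ≤ (w - z) * b :=
      mul_le_mul_of_nonneg_left ht.2.le (sub_pos.mpr hzw).le
    linarith
  · rw [h.legendreExtension_slopeInf hlt]
    refine le_sInf ?_
    rintro _ ⟨x, hx, rfl⟩
    obtain ⟨w, hw, rfl⟩ := exists_coe_of_mem_Ioo hx
    exact h.coe_toReal_legendre hw ▸ hle w hw

lemma legendreExtension_coe (h : SmoothConvexOn L f f' a b) {z : ℝ}
    (hz : slopeInf f' a b ≤ z) (hz' : (z : EReal) < slopeSup f' a b) :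
    legendreExtension L f' a b z = LegendreEE L z := by
  rcases hz.eq_or_lt with heq | hlt
  · have := h.legendreExtension_slopeInf_eq_legendre (hz.trans_lt hz') heq
    rwa [heq] at this
  · exact h.legendreExtension_of_mem_Ioo ⟨hlt, hz'⟩

lemma exists_legendre_eq_coe (h : SmoothConvexOn L f f' a b) {z : ℝ}
    (hz : slopeInf f' a b ≤ z) (hz' : (z : EReal) < slopeSup f' a b) :
    ∃ r : ℝ, 0 ≤ r ∧ LegendreEE L z = (r : EReal) := by
  obtain ⟨w, hzw, hw⟩ := EReal.lt_iff_exists_real_btwn.mp hz'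
  have hwI : (w : EReal) ∈ Ioo (slopeInf f' a b) (slopeSup f' a b) := ⟨hz.trans_lt hzw, hw⟩
  have hlt : LegendreEE L z < LegendreEE L w := by
    rw [← h.legendreExtension_coe hz hz', ← h.legendreExtension_of_mem_Ioo hwI]
    exact h.strictMonoOn_legendreExtension ⟨hz, hz'.le⟩ (Ioo_subset_Icc_self hwI) hzw
  have h0 := h.legendre_nonneg z
  have hfin : ((LegendreEE L z).toReal : EReal) = LegendreEE L z :=
    EReal.coe_toReal (hlt.trans_le le_top).ne (EReal.bot_lt_zero.trans_le h0).ne'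
  exact ⟨_, EReal.toReal_nonneg h0, hfin.symm⟩

lemma legendre_pos (h : SmoothConvexOn L f f' a b) {z : ℝ} (hz : z ∈ slopeRange f' a b) :
    0 < LegendreEE L z := by
  have hlt := hz.1.trans hz.2
  rw [← h.legendreExtension_of_mem_Ioo hz]
  exact (h.legendreExtension_nonneg hlt (left_mem_Icc.mpr hlt.le)).trans_lt
    (h.strictMonoOn_legendreExtension (left_mem_Icc.mpr hlt.le) (Ioo_subset_Icc_self hz) hz.1)

lemma legendreExtension_slopeSup_eq_top_iff (h : SmoothConvexOn L f f' a b)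
    (hlt : slopeInf f' a b < slopeSup f' a b) :
    legendreExtension L f' a b (slopeSup f' a b) = ⊤ ↔ slopeSup f' a b = ⊤ := by
  constructor
  · intro htop
    by_contra hne
    obtain ⟨x, hx⟩ := nonempty_Ioo.mpr hlt
    obtain ⟨z₀, hz₀, -⟩ := exists_coe_of_mem_Ioo hx
    obtain ⟨R, hR⟩ : ∃ R : ℝ, (R : EReal) = slopeSup f' a b :=
      ⟨_, EReal.coe_toReal hne (bot_le.trans_lt hlt).ne'⟩
    have hz₀R : z₀ < R := EReal.coe_lt_coe_iff.mp (hR ▸ hz₀.2)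
    have hb : 0 ≤ b := h.nonneg.trans h.lt.le
    suffices legendreExtension L f' a b (slopeSup f' a b) ≤
        (((LegendreEE L z₀).toReal + (R - z₀) * b : ℝ) : EReal) by
      rw [htop, top_le_iff] at this
      exact EReal.coe_ne_top _ this
    rw [h.legendreExtension_slopeSup hlt]
    refine sSup_le ?_
    rintro _ ⟨y, hy, rfl⟩
    obtain ⟨w, hw, rfl⟩ := exists_coe_of_mem_Ioo hy
    obtain ⟨-, -, t, ht, -, -, -, hle⟩ := h.exists_legendre_sub_bounds hz₀ hw
    rw [← h.coe_toReal_legendre hw, EReal.coe_le_coe_iff]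
    have hwR : w < R := EReal.coe_lt_coe_iff.mp (hR ▸ hw.2)
    have h1 : (w - z₀) * t ≤ (R - z₀) * t :=
      mul_le_mul_of_nonneg_right (by linarith) (h.pos ht).le
    have h2 : (R - z₀) * t ≤ (R - z₀) * b := mul_le_mul_of_nonneg_left ht.2.le (by linarith)
    linarith
  · intro htop
    rw [EReal.eq_top_iff_forall_lt]
    intro y
    obtain ⟨t, ht⟩ := nonempty_Ioo.mpr h.lt
    obtain ⟨z₀, hz₀, -⟩ := EReal.lt_iff_exists_real_btwn.mp hlt
    have hw : ((max (z₀ + 1) ((y + f t) / t + 1) : ℝ) : EReal) ∈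
        Ioo (slopeInf f' a b) (slopeSup f' a b) := by
      refine ⟨hz₀.trans ?_, htop ▸ EReal.coe_lt_top _⟩
      exact EReal.coe_lt_coe_iff.mpr ((lt_add_one z₀).trans_le (le_max_left _ _))
    refine lt_of_lt_of_le ?_ ((h.le_legendre _ ht).trans (h.le_legendreExtension_slopeSup hw))
    have h1 : (y + f t) / t < max (z₀ + 1) ((y + f t) / t + 1) :=
      (lt_add_one _).trans_le (le_max_right _ _)
    rw [div_lt_iff₀ (h.pos ht)] at h1
    exact EReal.coe_lt_coe_iff.mpr (by linarith)

lemma legendreExtension_slopeInf_le_coe (h : SmoothConvexOn L f f' a b) {t : ℝ} (ht : t ∈ Ioo a b)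
    (hR : (f' t : EReal) < slopeSup f' a b) :
    legendreExtension L f' a b (slopeInf f' a b) ≤ ((f' t * t - f t : ℝ) : EReal) := by
  rw [← h.legendre_slope ht, ← h.legendreExtension_coe (slopeInf_le ht) hR]
  exact h.strictMonoOn_legendreExtension.monotoneOn (left_mem_Icc.mpr h.slopeInf_le_slopeSup)
    ⟨slopeInf_le ht, hR.le⟩ (slopeInf_le ht)

lemma legendreExtension_slopeInf_eq_zero_iff_tendsto (h : SmoothConvexOn L f f' 0 b)
    (hlt : slopeInf f' 0 b < slopeSup f' 0 b) :
    legendreExtension L f' 0 b (slopeInf f' 0 b) = 0 ↔ Tendsto L (𝓝[>] 0) (𝓝 0) := by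
  obtain ⟨u, hu, huR⟩ := exists_lt_of_slopeInf_lt hlt
  have hcongr : Tendsto L (𝓝[>] 0) (𝓝 0) ↔ Tendsto f (𝓝[>] 0) (𝓝 0) := by
    rw [← EReal.tendsto_coe, EReal.coe_zero]
    refine tendsto_congr' ?_
    filter_upwards [Ioo_mem_nhdsGT h.lt] with t ht using h.coe_eq t ht
  have hupper : Tendsto (fun t => f' u * t) (𝓝[>] 0) (𝓝 0) := by
    have : Continuous fun t => f' u * t := by fun_prop
    simpa using (this.tendsto 0).mono_left (nhdsWithin_le_nhds (s := Ioi 0))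
  have hslope : ∀ᶠ t in 𝓝[>] (0 : ℝ), t ∈ Ioo 0 b ∧ f' t ≤ f' u := by
    filter_upwards [Ioo_mem_nhdsGT hu.1] with t ht
    have htI : t ∈ Ioo 0 b := ⟨ht.1, ht.2.trans hu.2⟩
    exact ⟨htI, h.monotoneOn htI hu ht.2.le⟩
  rw [hcongr]
  constructor
  · intro hG
    refine tendsto_order.mpr ⟨fun y hy => ?_, fun y hy => ?_⟩
    · rw [h.legendreExtension_slopeInf hlt] at hG
      have hneg : sInf (LegendreEE L '' Ioo (slopeInf f' 0 b) (slopeSup f' 0 b)) <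
          ((-y : ℝ) : EReal) := by
        rw [hG]
        exact_mod_cast neg_pos.mpr hy
      obtain ⟨_, ⟨x, hx, rfl⟩, hxy⟩ := sInf_lt_iff.mp hneg
      obtain ⟨w, hw, rfl⟩ := exists_coe_of_mem_Ioo hx
      rw [← h.coe_toReal_legendre hw, EReal.coe_lt_coe_iff] at hxy
      have hlim : Tendsto (fun t => w * t - (LegendreEE L w).toReal) (𝓝[>] 0)
          (𝓝 (w * 0 - (LegendreEE L w).toReal)) := by
        have : Continuous fun t => w * t - (LegendreEE L w).toReal := by fun_prop
        exact (this.tendsto 0).mono_left nhdsWithin_le_nhds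
      filter_upwards [hlim.eventually_const_lt (by linarith : y < _), hslope] with t ht htI
      linarith [h.le_toReal_legendre hw htI.1]
    · filter_upwards [hupper.eventually_lt_const hy, hslope] with t ht htI
      have := mul_le_mul_of_nonneg_right htI.2 htI.1.1.le
      linarith [h.slope_mul_sub_nonneg htI.1]
  · intro hf
    refine le_antisymm ?_ (h.legendreExtension_nonneg hlt (left_mem_Icc.mpr hlt.le))
    have hlim := EReal.tendsto_coe.mpr (hupper.sub hf)
    rw [sub_zero, EReal.coe_zero] at hlim
    refine ge_of_tendsto hlim ?_
    filter_upwards [hslope] with t ht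
    have hR := (EReal.coe_le_coe_iff.mpr ht.2).trans_lt huR
    refine (h.legendreExtension_slopeInf_le_coe ht.1 hR).trans (EReal.coe_le_coe_iff.mpr ?_)
    have := mul_le_mul_of_nonneg_right ht.2 ht.1.1.le
    linarith

lemma exists_slopeInf_eq_coe (h : SmoothConvexOn L f f' a b) (ha : 0 < a) :
    ∃ z : ℝ, slopeInf f' a b = z := by
  refine ⟨_, (EReal.coe_toReal h.slopeInf_lt_top.ne fun hbot => ?_).symm⟩
  obtain ⟨t, ht⟩ := nonempty_Ioo.mpr h.lt
  obtain ⟨s, hs, hst⟩ := exists_lt_of_slopeInf_lt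
    (hbot ▸ EReal.bot_lt_coe (f' t - (f' t * t - f t + 1) / a))
  have hst := EReal.coe_lt_coe_iff.mp hst
  have hκ := h.slope_mul_sub_nonneg ht
  have hcs : 0 < (f' t * t - f t + 1) / a := by positivity
  have hmul : (f' t * t - f t + 1) / a * a = f' t * t - f t + 1 := by field_simp
  have h1 := h.slope_mul_sub_nonneg hs
  have h2 := h.tangent_real ht hs
  nlinarith [mul_lt_mul_of_pos_right hs.1 hcs, mul_lt_mul_of_pos_right hst (h.pos hs)]

/-- The chord from the origin bounds `L` from above by the minimal slope. -/
lemma le_slopeInf_mul (h : SmoothConvexOn L f f' a b) (hL : EpiConvex L) {z : ℝ}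
    (hz : slopeInf f' a b = z) {s : ℝ} (hs : s ∈ Icc 0 a) : L s ≤ ((z * s : ℝ) : EReal) := by
  rcases hs.1.eq_or_lt with rfl | hs0
  · simp [h.zero]
  refine le_coe_of_forall_pos_le_add fun δ hδ => ?_
  have hlt : slopeInf f' a b < ((z + δ / s : ℝ) : EReal) := by
    rw [hz, EReal.coe_lt_coe_iff]
    linarith [div_pos hδ hs0]
  obtain ⟨t, ht, htz⟩ := exists_lt_of_slopeInf_lt hlt
  have htz := EReal.coe_lt_coe_iff.mp htz
  have ht0 := h.pos ht
  have hst : s / t < 1 := (div_lt_one ht0).mpr (hs.2.trans_lt ht.1)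
  have hconv := hL (sub_pos.mpr hst) (div_pos hs0 ht0) (sub_add_cancel 1 (s / t))
    (h.zero.trans EReal.coe_zero.symm).le (h.coe_eq t ht).le
  rw [mul_zero, zero_add, div_mul_cancel₀ s ht0.ne'] at hconv
  refine hconv.trans (EReal.coe_le_coe_iff.mpr ?_)
  have h1 := h.slope_mul_sub_nonneg ht
  calc 0 + s / t * f t ≤ s / t * (f' t * t) := by
        rw [zero_add]
        exact mul_le_mul_of_nonneg_left (by linarith) (div_pos hs0 ht0).le
    _ = f' t * s := by field_simp
    _ ≤ (z + δ / s) * s := mul_le_mul_of_nonneg_right htz.le hs0.le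
    _ = z * s + δ := by field_simp

lemma eDifferentiableAt_of_legendre_eq_zero (h : SmoothConvexOn L f f' a b) (hL : EpiConvex L)
    (ha : 0 < a) {z : ℝ} (hz : slopeInf f' a b = z) (hK : LegendreEE L z = 0) :
    EDifferentiableAt L a ∧ ∃ p : ℝ, ∀ s ∈ Icc (0 : ℝ) a, L s = ((p * s : ℝ) : EReal) := by
  have hlower : ∀ s : ℝ, ((z * s : ℝ) : EReal) ≤ L s := by
    intro s
    rw [mul_comm, EReal.coe_mul, ← EReal.sub_nonpos, ← hK]
    exact le_iSup (fun t : ℝ => (t : EReal) * z - L t) s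
  have hlin : ∀ s ∈ Icc (0 : ℝ) a, L s = ((z * s : ℝ) : EReal) :=
    fun s hs => (h.le_slopeInf_mul hL hz hs).antisymm (hlower s)
  have hLa := hlin a (right_mem_Icc.mpr ha.le)
  refine ⟨⟨⟨_, hLa⟩, z, ?_⟩, z, hlin⟩
  rw [← nhdsLT_sup_nhdsGT, tendsto_sup]
  constructor
  · refine tendsto_const_nhds.congr' ?_
    filter_upwards [Ioo_mem_nhdsLT ha] with s hs
    have hne : s - a ≠ 0 := (sub_neg.mpr hs.2).ne
    rw [hLa, hlin s ⟨hs.1.le, hs.2.le⟩, ← EReal.coe_sub, ← EReal.coe_mul]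
    congr 1
    field_simp
  · have hslope := h.tendsto_slope_slopeInf
    rw [hz] at hslope
    refine tendsto_of_tendsto_of_tendsto_of_le_of_le' tendsto_const_nhds hslope ?_ ?_
    · filter_upwards [Ioo_mem_nhdsGT h.lt] with s hs
      have hpos : 0 < s - a := sub_pos.mpr hs.1
      have := hlower s
      rw [h.coe_eq s hs, EReal.coe_le_coe_iff] at this
      rw [hLa, h.coe_eq s hs, ← EReal.coe_sub, ← EReal.coe_mul, EReal.coe_le_coe_iff,
        ← div_eq_mul_inv, le_div_iff₀ hpos]
      linarith
    · filter_upwards [Ioo_mem_nhdsGT h.lt] with s hs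
      have hpos : 0 < s - a := sub_pos.mpr hs.1
      have := h.tangent s hs a
      rw [hLa, EReal.coe_le_coe_iff] at this
      rw [hLa, h.coe_eq s hs, ← EReal.coe_sub, ← EReal.coe_mul, EReal.coe_le_coe_iff,
        ← div_eq_mul_inv, div_le_iff₀ hpos]
      linarith

lemma legendre_eq_zero_of_eDifferentiableAt (h : SmoothConvexOn L f f' a b) (hL : EpiConvex L)
    (ha : 0 < a) (hd : EDifferentiableAt L a) {p : ℝ}
    (hp : ∀ s ∈ Icc (0 : ℝ) a, L s = ((p * s : ℝ) : EReal)) {z : ℝ}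
    (hz : slopeInf f' a b = z) : LegendreEE L z = 0 := by
  obtain ⟨-, d, hd⟩ := hd
  have hLa := hp a (right_mem_Icc.mpr ha.le)
  have hdp : (p : EReal) = d := by
    refine tendsto_nhds_unique (tendsto_const_nhds.congr' ?_)
      (hd.mono_left (nhdsLT_le_nhdsNE a))
    filter_upwards [Ioo_mem_nhdsLT ha] with s hs
    have hne : s - a ≠ 0 := (sub_neg.mpr hs.2).ne
    rw [hLa, hp s ⟨hs.1.le, hs.2.le⟩, ← EReal.coe_sub, ← EReal.coe_mul]
    congr 1
    field_simp
  rw [← hdp] at hd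
  have hlower : ∀ s : ℝ, ((p * s : ℝ) : EReal) ≤ L s := by
    intro s
    convert hL.tangent_le hLa hd s using 2
    ring
  have hlower_real : ∀ s ∈ Ioo a b, p * s ≤ f s := by
    intro s hs
    exact EReal.coe_le_coe_iff.mp (h.coe_eq s hs ▸ hlower s)
  have hzp : z ≤ p := by
    refine EReal.coe_le_coe_iff.mp (ge_of_tendsto (hd.mono_left (nhdsGT_le_nhdsNE a)) ?_)
    filter_upwards [Ioo_mem_nhdsGT h.lt] with s hs
    have hpos : 0 < s - a := sub_pos.mpr hs.1
    rw [hLa, h.coe_eq s hs, ← EReal.coe_sub, ← EReal.coe_mul, EReal.coe_le_coe_iff,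
      ← div_eq_mul_inv, le_div_iff₀ hpos]
    have hlim : Tendsto (fun u => p * u + z * (s - u)) (𝓝[>] a) (𝓝 (p * a + z * (s - a))) := by
      have : Continuous fun u => p * u + z * (s - u) := by fun_prop
      exact (this.tendsto a).mono_left nhdsWithin_le_nhds
    have : p * a + z * (s - a) ≤ f s := by
      refine le_of_tendsto hlim ?_
      filter_upwards [Ioo_mem_nhdsGT hs.1] with u hu
      have huI : u ∈ Ioo a b := ⟨hu.1, hu.2.trans hs.2⟩
      have hzu : z ≤ f' u := EReal.coe_le_coe_iff.mp (hz ▸ slopeInf_le huI)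
      have := mul_le_mul_of_nonneg_right hzu (sub_pos.mpr hu.2).le
      linarith [h.tangent_real huI hs, hlower_real u huI]
    linarith
  have hpz : p ≤ z := by
    rw [← EReal.coe_le_coe_iff, ← hz]
    refine le_sInf ?_
    rintro _ ⟨t, ht, rfl⟩
    have := h.tangent t ht a
    rw [hLa, EReal.coe_le_coe_iff] at this
    have h1 := hlower_real t ht
    refine EReal.coe_le_coe_iff.mpr (le_of_mul_le_mul_right ?_ (sub_pos.mpr ht.1))
    linarith
  rw [hzp.antisymm hpz]
  refine le_antisymm ?_ (h.legendre_nonneg p)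
  exact legendre_le_of_forall_le (q := 0) (by simpa using hlower)

lemma legendreExtension_slopeInf_eq_zero_iff (h : SmoothConvexOn L f f' a b) (hL : EpiConvex L)
    (hlt : slopeInf f' a b < slopeSup f' a b) :
    legendreExtension L f' a b (slopeInf f' a b) = 0 ↔
      ((0 < a ∧ EDifferentiableAt L a ∧
          ∃ p : ℝ, ∀ s ∈ Icc (0 : ℝ) a, L s = ((p * s : ℝ) : EReal)) ∨
        (a = 0 ∧ Tendsto L (𝓝[>] 0) (𝓝 0))) := by
  rcases h.nonneg.eq_or_lt with rfl | ha
  · simpa using h.legendreExtension_slopeInf_eq_zero_iff_tendsto hlt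
  · obtain ⟨z, hz⟩ := h.exists_slopeInf_eq_coe ha
    rw [h.legendreExtension_slopeInf_eq_legendre hlt hz]
    constructor
    · exact fun hK => Or.inl ⟨ha, h.eDifferentiableAt_of_legendre_eq_zero hL ha hz hK⟩
    · rintro (⟨-, hd, p, hp⟩ | ⟨rfl, -⟩)
      · exact h.legendre_eq_zero_of_eDifferentiableAt hL ha hd hp hz
      · exact absurd ha (lt_irrefl _)

lemma slope_eq_of_affineOnIoc (h : SmoothConvexOn L f f' a b) {t p q : ℝ}
    (hpq : ∀ s ∈ Ioc a t, L s = ((p * s + q : ℝ) : EReal)) {s : ℝ} (hs : s ∈ Ioo a b)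
    (hst : s < t) : f' s = p := by
  have hlin : HasDerivAt (fun u => p * u + q) p s := by
    simpa using ((hasDerivAt_id s).const_mul p).add_const q
  refine (h.deriv s hs).unique (hlin.congr_of_eventuallyEq ?_)
  filter_upwards [Ioo_mem_nhds hs.1 hs.2, Ioo_mem_nhds hs.1 hst] with u hu hut
  exact EReal.coe_injective ((h.coe_eq u hu).symm.trans (hpq u ⟨hut.1, hut.2.le⟩))

lemma tildeOf_lt (h : SmoothConvexOn L f f' a b) {t : ℝ} (ht : t ∈ Ioo a b)
    (hlt : slopeInf f' a b < (f' t : EReal)) : tildeOf L a < t := by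
  obtain ⟨z, hz, hzt⟩ := EReal.lt_iff_exists_real_btwn.mp hlt
  obtain ⟨s, hs, rfl⟩ := h.exists_slope_eq hz (hzt.trans_le (le_slopeSup ht))
  have hst : s < t := by
    by_contra! hle
    exact absurd (h.monotoneOn ht hs hle) (EReal.coe_lt_coe_iff.mp hzt).not_ge
  refine lt_of_le_of_lt (csSup_le (insert_nonempty _ _) ?_) hst
  rintro r (rfl | ⟨-, p, q, hpq⟩)
  · exact hs.1.le
  by_contra! hsr
  refine hz.not_ge (le_sInf ?_)
  rintro _ ⟨v, hv, rfl⟩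
  refine EReal.coe_le_coe_iff.mpr ?_
  rcases le_total s v with hsv | hvs
  · exact h.monotoneOn hs hv hsv
  · rw [h.slope_eq_of_affineOnIoc hpq hs hsr, h.slope_eq_of_affineOnIoc hpq hv (hvs.trans_lt hsr)]

lemma slope_lt_of_strictConvex (h : SmoothConvexOn L f f' a b) {p q : ℝ} (hp : p ∈ Ioo a b)
    (hq : q ∈ Ioo a b) (hpq : p < q)
    (hconv : L ((1 / 2 : ℝ) * p + (1 / 2 : ℝ) * q) <
      ((1 / 2 : ℝ) : EReal) * L p + ((1 / 2 : ℝ) : EReal) * L q) : f' p < f' q := by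
  have hm : (1 / 2 : ℝ) * p + (1 / 2 : ℝ) * q ∈ Ioo a b :=
    ⟨by linarith [hp.1, hq.1], by linarith [hp.2, hq.2]⟩
  rw [h.coe_eq _ hm, h.coe_eq p hp, h.coe_eq q hq, ← EReal.coe_mul, ← EReal.coe_mul,
    ← EReal.coe_add, EReal.coe_lt_coe_iff] at hconv
  have h1 := h.tangent_real hp hm
  have h2 := h.tangent_real hq hm
  by_contra! hle
  nlinarith [mul_le_mul_of_nonneg_right hle (sub_pos.mpr hpq).le]

end SmoothConvexOn

theorem statement17
    {ι : Type*} (lf : Filter ι) [lf.NeBot]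
    (μ : ι → Measure ℝ) [∀ i, IsProbabilityMeasure (μ i)]
    (c : ι → ℝ) (hc : ∀ i, 0 < c i) (hc0 : Filter.Tendsto c lf (nhds (0 : ℝ)))
    (L : ℝ → EReal) (hL : L = genLogMGF lf μ c)
    (lam : ℝ) (hlam : 0 ≤ lam) (eps : ℝ) (heps : 0 < eps)
    (hdiff : ∀ t ∈ Set.Ioo lam (lam + eps), EDifferentiableAt L t) :
    (∀ z : ℝ, rightLimE (rightDerivE L) lam ≤ (z : EReal) → (z : EReal) < leftLimE (rightDerivE L) (lam + eps) →
      ∃ r : ℝ, 0 ≤ r ∧ LegendreEE L ((z : ℝ) : EReal) = (r : EReal)) ∧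
    (∃ G : EReal → EReal,
      (∀ z : ℝ, rightLimE (rightDerivE L) lam ≤ (z : EReal) → (z : EReal) < leftLimE (rightDerivE L) (lam + eps) →
        G ((z : ℝ) : EReal) = LegendreEE L ((z : ℝ) : EReal)) ∧
      (∀ z ∈ Set.Icc (rightLimE (rightDerivE L) lam) (leftLimE (rightDerivE L) (lam + eps)), (0 : EReal) ≤ G z) ∧
      StrictMonoOn G (Set.Icc (rightLimE (rightDerivE L) lam) (leftLimE (rightDerivE L) (lam + eps))) ∧
      ContinuousOn G (Set.Icc (rightLimE (rightDerivE L) lam) (leftLimE (rightDerivE L) (lam + eps))) ∧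
      (G (leftLimE (rightDerivE L) (lam + eps)) = ⊤ ↔ leftLimE (rightDerivE L) (lam + eps) = ⊤) ∧
      (G (rightLimE (rightDerivE L) lam) = 0 ↔
        ((0 < lam ∧ EDifferentiableAt L lam ∧
            ∃ a : ℝ, ∀ s ∈ Set.Icc (0:ℝ) lam, L s = ((a * s : ℝ) : EReal)) ∨
          (lam = 0 ∧ Filter.Tendsto L (nhdsWithin 0 (Set.Ioi 0)) (nhds (0 : EReal)))))) ∧
    (∀ z : ℝ, rightLimE (rightDerivE L) lam < (z : EReal) → (z : EReal) < leftLimE (rightDerivE L) (lam + eps) →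
      (0 : EReal) < LegendreEE L ((z : ℝ) : EReal)) ∧
    StrictConvexOn ℝ {z : ℝ | rightLimE (rightDerivE L) lam < (z : EReal) ∧ (z : EReal) < leftLimE (rightDerivE L) (lam + eps)} (fun z : ℝ => (LegendreEE L ((z : ℝ) : EReal)).toReal) ∧
    ((tildeOf L lam < lam + eps ∧
        ∀ p ∈ Set.Ioo (tildeOf L lam) (lam + eps), ∀ q ∈ Set.Ioo (tildeOf L lam) (lam + eps),
          p ≠ q → ∀ a b : ℝ, 0 < a → 0 < b → a + b = 1 →
            L (a * p + b * q) < (a : EReal) * L p + (b : EReal) * L q) →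
      DifferentiableOn ℝ (fun z : ℝ => (LegendreEE L ((z : ℝ) : EReal)).toReal) {z : ℝ | rightLimE (rightDerivE L) lam < (z : EReal) ∧ (z : EReal) < leftLimE (rightDerivE L) (lam + eps)}) := by
  subst hL
  have hconv := genLogMGF_epiConvex lf μ c hc
  obtain ⟨f, f', h⟩ := hconv.exists_smoothConvexOn (genLogMGF_zero lf μ c) hlam
    (lt_add_of_pos_right lam heps) hdiff
  simp only [h.rightLimE_eq, h.leftLimE_eq]
  refine ⟨fun z => h.exists_legendre_eq_coe, ?_, fun z hz hz' => h.legendre_pos ⟨hz, hz'⟩,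
    h.strictConvexOn_legendre, ?_⟩
  · rcases h.slopeInf_le_slopeSup.eq_or_lt with heq | hlt
    · rw [← heq]
      classical
      refine ⟨fun _ => if (0 < lam ∧ EDifferentiableAt (genLogMGF lf μ c) lam ∧
          ∃ a : ℝ, ∀ s ∈ Set.Icc (0 : ℝ) lam, genLogMGF lf μ c s = ((a * s : ℝ) : EReal)) ∨
          (lam = 0 ∧ Tendsto (genLogMGF lf μ c) (𝓝[>] 0) (𝓝 0)) then 0 else 1,
        fun z hz hz' => absurd hz hz'.not_ge, fun z _ => ?_, ?_, continuousOn_const, ?_, ?_⟩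
      · split_ifs <;> simp
      · simp
      · refine iff_of_false ?_ h.slopeInf_lt_top.ne
        split_ifs
        · exact EReal.zero_ne_top
        · exact EReal.coe_ne_top 1
      · exact ⟨fun h1 => by_contra fun h2 => one_ne_zero ((if_neg h2).symm.trans h1), fun h2 => if_pos h2⟩
    · exact ⟨SmoothConvexOn.legendreExtension (genLogMGF lf μ c) f' lam (lam + eps),
        fun z => h.legendreExtension_coe, fun z => h.legendreExtension_nonneg hlt,
        h.strictMonoOn_legendreExtension, h.continuousOn_legendreExtension hlt,
        h.legendreExtension_slopeSup_eq_top_iff hlt,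
        h.legendreExtension_slopeInf_eq_zero_iff hconv hlt⟩
  · rintro ⟨-, hstrict⟩
    refine h.differentiableOn_legendre fun t ht hlt => ⟨max (tildeOf (genLogMGF lf μ c) lam) lam,
      max_lt (h.tildeOf_lt ht hlt) ht.1, fun p hp q hq hpq => ?_⟩
    have hp' := max_lt_iff.mp hp.1
    have hq' := max_lt_iff.mp hq.1
    exact h.slope_lt_of_strictConvex ⟨hp'.2, hp.2⟩ ⟨hq'.2, hq.2⟩ hpq
      (hstrict p ⟨hp'.1, hp.2⟩ q ⟨hq'.1, hq.2⟩ hpq.ne _ _ one_half_pos one_half_pos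
        (add_halves 1))
end
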